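/- arXiv:1503.05450 — 5 statements merged into one kernel-verified Lean document; each statement's English description precedes it below -/
import Mathlib

section
/- Let k be an algebraically closed field, A a finite-dimensional associative unital k-algebra, and let T = U ⊕ X be a finite-dimensional left A-module with X indecomposable, X not in add U, and Ext^i_A(T,T) = 0 for all i ≥ 1. Suppose there exists a short exact sequence 0 → Y → E →ε→ X → 0 of finite-dimensional left A-modules in which ε : E → X is a right add U-approximation. Set B = End_A(T). Then M := Hom_A(U ⊕ Y, T), regarded as a left B-module via postcomposition, is a tilting B-module of projective dimension exactly 1; that is, M has projective dimension 1 over B, Ext^1_B(M,M) = 0, and there exists an exact sequence 0 → B → M_0 → M_1 → 0 of left B-modules with M_0, M_1 ∈ add M. -/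
open CategoryTheory

noncomputable section

/-- `M` belongs to `add U`: `M` is (isomorphic to) a direct summand of a finite
direct sum of copies of `U`, i.e. `M` is a split submodule of some `U ^ n`. -/
def InAdd (A : Type) [Ring A] (U : Type) [AddCommGroup U] [Module A U]
    (M : Type) [AddCommGroup M] [Module A M] : Prop :=
  ∃ (n : ℕ) (i : M →ₗ[A] (Fin n → U)) (p : (Fin n → U) →ₗ[A] M), p ∘ₗ i = LinearMap.id

/-- `M` belongs to `gen U`: there is a surjection `U ^ n → M` for some `n ≥ 1`. -/
def InGen (A : Type) [Ring A] (U : Type) [AddCommGroup U] [Module A U]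
    (M : Type) [AddCommGroup M] [Module A M] : Prop :=
  ∃ n : ℕ, 1 ≤ n ∧ ∃ p : (Fin n → U) →ₗ[A] M, Function.Surjective p

/-- `M` belongs to `cogen U`: there is an injection `M → U ^ n` for some `n ≥ 1`. -/
def InCogen (A : Type) [Ring A] (U : Type) [AddCommGroup U] [Module A U]
    (M : Type) [AddCommGroup M] [Module A M] : Prop :=
  ∃ n : ℕ, 1 ≤ n ∧ ∃ i : M →ₗ[A] (Fin n → U), Function.Injective i

/-- `ε : E → X` is a right `add U`-approximation of `X`. -/
def IsRightAddApprox (A : Type) [Ring A] (U : Type) [AddCommGroup U] [Module A U]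
    {E X : Type} [AddCommGroup E] [Module A E] [AddCommGroup X] [Module A X]
    (ε : E →ₗ[A] X) : Prop :=
  InAdd A U E ∧ ∀ (C : Type) [AddCommGroup C] [Module A C], InAdd A U C →
    ∀ f : C →ₗ[A] X, ∃ g : C →ₗ[A] E, ε ∘ₗ g = f

/-- `ε : E → X` is a minimal right `add U`-approximation of `X`. -/
def IsMinimalRightAddApprox (A : Type) [Ring A] (U : Type) [AddCommGroup U] [Module A U]
    {E X : Type} [AddCommGroup E] [Module A E] [AddCommGroup X] [Module A X]
    (ε : E →ₗ[A] X) : Prop :=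
  IsRightAddApprox A U ε ∧ ∀ g : E →ₗ[A] E, ε ∘ₗ g = ε → Function.Bijective g

/-- `μ : Y → E` is a left `add U`-approximation of `Y`. -/
def IsLeftAddApprox (A : Type) [Ring A] (U : Type) [AddCommGroup U] [Module A U]
    {Y E : Type} [AddCommGroup Y] [Module A Y] [AddCommGroup E] [Module A E]
    (μ : Y →ₗ[A] E) : Prop :=
  InAdd A U E ∧ ∀ (C : Type) [AddCommGroup C] [Module A C], InAdd A U C →
    ∀ f : Y →ₗ[A] C, ∃ g : E →ₗ[A] C, g ∘ₗ μ = f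

/-- `μ : Y → E` is a minimal left `add U`-approximation of `Y`. -/
def IsMinimalLeftAddApprox (A : Type) [Ring A] (U : Type) [AddCommGroup U] [Module A U]
    {Y E : Type} [AddCommGroup Y] [Module A Y] [AddCommGroup E] [Module A E]
    (μ : Y →ₗ[A] E) : Prop :=
  IsLeftAddApprox A U μ ∧ ∀ g : E →ₗ[A] E, g ∘ₗ μ = μ → Function.Bijective g

/-- A module is indecomposable: it is nonzero and is not the internal direct sum of two
nonzero submodules. -/
def IsIndecomposableModule (A : Type) [Ring A] (M : Type) [AddCommGroup M] [Module A M] :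
    Prop :=
  Nontrivial M ∧ ∀ N₁ N₂ : Submodule A M, IsCompl N₁ N₂ → N₁ = ⊥ ∨ N₂ = ⊥

/-- A module is basic: it is an internal direct sum of finitely many indecomposable
submodules that are pairwise non-isomorphic. -/
def IsBasicModule (A : Type) [Ring A] (M : Type) [AddCommGroup M] [Module A M] : Prop :=
  ∃ (n : ℕ) (N : Fin n → Submodule A M),
    DirectSum.IsInternal N ∧ (∀ i, IsIndecomposableModule A (N i)) ∧
      ∀ i j : Fin n, i ≠ j → IsEmpty ((N i) ≃ₗ[A] (N j))

/-- `AddCoresChain A T n M` expresses that there is an exact sequence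
`0 → M → T₀ → T₁ → ⋯ → Tₙ → 0` with all `Tᵢ ∈ add T`
(encoded recursively via cokernels). -/
def AddCoresChain (A : Type) [Ring A] (T : Type) [AddCommGroup T] [Module A T] :
    (n : ℕ) → (M : Type) → [AddCommGroup M] → [Module A M] → Prop
  | 0, M, _, _ => InAdd A T M
  | n + 1, M, _, _ => ∃ (T₀ : Type) (_ : AddCommGroup T₀) (_ : Module A T₀)
      (f : M →ₗ[A] T₀), Function.Injective f ∧ InAdd A T T₀ ∧
        AddCoresChain A T n (T₀ ⧸ LinearMap.range f)

/-- The self-extension groups `Ext^i_A(T, T)` vanish for all `i ≥ 1`. -/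
def ExtSelfVanish (k : Type) [Field k] (A : Type) [Ring A] [Algebra k A]
    (T : Type) [AddCommGroup T] [Module A T] : Prop :=
  ∀ i : ℕ, 1 ≤ i → Subsingleton
    (((Ext k (ModuleCat.{0} A) i).obj (Opposite.op (ModuleCat.of A T))).obj (ModuleCat.of A T))

/-- `T` is a semi-tilting `A`-module: `Ext^i_A(T,T) = 0` for all `i ≥ 1` and there is an
exact sequence `0 → A → T₀ → ⋯ → Tₙ → 0` with all `Tᵢ ∈ add T`. -/
def IsSemiTilting (k : Type) [Field k] (A : Type) [Ring A] [Algebra k A]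
    (T : Type) [AddCommGroup T] [Module A T] : Prop :=
  ExtSelfVanish k A T ∧ ∃ n : ℕ, AddCoresChain A T n A

/-- `M` has projective dimension at most `1` over `B`: it admits a projective
resolution `0 → P₁ → P₀ → M → 0`. -/
def HasProjDimLE1 (B : Type) [Ring B] (M : Type) [AddCommGroup M] [Module B M] : Prop :=
  ∃ (P₀ P₁ : Type) (_ : AddCommGroup P₀) (_ : Module B P₀)
    (_ : AddCommGroup P₁) (_ : Module B P₁),
    Module.Projective B P₀ ∧ Module.Projective B P₁ ∧
      ∃ (ι : P₁ →ₗ[B] P₀) (π : P₀ →ₗ[B] M),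
        Function.Injective ι ∧ Function.Surjective π ∧ LinearMap.range ι = LinearMap.ker π

/-- `M` has projective dimension exactly `1` over `B`. -/
def HasProjDimEq1 (B : Type) [Ring B] (M : Type) [AddCommGroup M] [Module B M] : Prop :=
  HasProjDimLE1 B M ∧ ¬ Module.Projective B M

/-- `Ext^1_B(M, M) = 0`. -/
def ExtOneSelfVanish (B : Type) [Ring B] (M : Type) [AddCommGroup M] [Module B M] : Prop :=
  Subsingleton
    (((Ext ℤ (ModuleCat.{0} B) 1).obj (Opposite.op (ModuleCat.of B M))).obj (ModuleCat.of B M))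

/-- `M` is a tilting `B`-module of projective dimension exactly one. -/
def IsTiltingOfProjDimOne (B : Type) [Ring B] (M : Type) [AddCommGroup M] [Module B M] :
    Prop :=
  HasProjDimEq1 B M ∧ ExtOneSelfVanish B M ∧
    ∃ (M₀ M₁ : Type) (_ : AddCommGroup M₀) (_ : Module B M₀)
      (_ : AddCommGroup M₁) (_ : Module B M₁),
      InAdd B M M₀ ∧ InAdd B M M₁ ∧
        ∃ (f : B →ₗ[B] M₀) (g : M₀ →ₗ[B] M₁),
          Function.Injective f ∧ Function.Surjective g ∧ LinearMap.range f = LinearMap.ker g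

/-- The right action (by precomposition) of `(End_A T)ᵐᵒᵖ` on `Hom_A(T, N)`,
making `Hom_A(T, N)` a right `End_A T`-module. -/
instance endOpModule (A : Type) [Ring A] (T : Type) [AddCommGroup T] [Module A T]
    (N : Type) [AddCommGroup N] [Module A N] :
    Module (Module.End A T)ᵐᵒᵖ (T →ₗ[A] N) where
  smul b f := f ∘ₗ b.unop
  one_smul f := rfl
  mul_smul x y f := rfl
  smul_zero b := rfl
  smul_add b f g := rfl
  add_smul x y f := by
    show f ∘ₗ (x.unop + y.unop) = f ∘ₗ x.unop + f ∘ₗ y.unop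
    ext t
    simp
  zero_smul f := by
    show f ∘ₗ (0 : Module.End A T) = 0
    ext t
    simp

@[simp] lemma endOpModule_smul_def (A : Type) [Ring A] (T : Type) [AddCommGroup T]
    [Module A T] (N : Type) [AddCommGroup N] [Module A N]
    (b : (Module.End A T)ᵐᵒᵖ) (f : T →ₗ[A] N) : b • f = f ∘ₗ b.unop := rfl

/-- Precomposition with `g : N → N'`, as a map of left `End_A T`-modules
`Hom_A(N', T) → Hom_A(N, T)`. -/
def homPrecomp (A : Type) [Ring A] {T N N' : Type} [AddCommGroup T] [Module A T]
    [AddCommGroup N] [Module A N] [AddCommGroup N'] [Module A N'] (g : N →ₗ[A] N') :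
    (N' →ₗ[A] T) →ₗ[Module.End A T] (N →ₗ[A] T) where
  toFun f := f ∘ₗ g
  map_add' f₁ f₂ := rfl
  map_smul' b f := rfl

/-- Postcomposition with `g : N → N'`, as a map of right `End_A T`-modules
`Hom_A(T, N) → Hom_A(T, N')`. -/
def homPostcomp (A : Type) [Ring A] {T N N' : Type} [AddCommGroup T] [Module A T]
    [AddCommGroup N] [Module A N] [AddCommGroup N'] [Module A N'] (g : N →ₗ[A] N') :
    (T →ₗ[A] N) →ₗ[(Module.End A T)ᵐᵒᵖ] (T →ₗ[A] N') where
  toFun f := g ∘ₗ f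
  map_add' f₁ f₂ := by ext t; simp
  map_smul' b f := rfl

theorem ext1_iff_res (R : Type) [Ring R] (A : Type) [Ring A] [Linear R (ModuleCat.{0} A)]
    (M N : ModuleCat.{0} A) (P : ProjectiveResolution M) :
    Subsingleton (((Ext R (ModuleCat.{0} A) 1).obj (Opposite.op M)).obj N) ↔
      ∀ φ : P.complex.X 1 ⟶ N, P.complex.d 2 1 ≫ φ = 0 →
        ∃ ψ : P.complex.X 0 ⟶ N, P.complex.d 1 0 ≫ ψ = φ := by
  rw [← ModuleCat.isZero_iff_subsingleton, (P.isoExt (R := R) 1 N).isZero_iff,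
    ← HomologicalComplex.exactAt_iff_isZero_homology,
    HomologicalComplex.exactAt_iff' _ 0 1 2 (by simp) (by simp), ShortComplex.moduleCat_exact_iff]
  rfl

theorem ext1_data (R : Type) [Ring R] (A : Type) [Ring A] [Linear R (ModuleCat.{0} A)]
    (M N : Type) [AddCommGroup M] [Module A M] [AddCommGroup N] [Module A N] :
    ∃ (P₀ P₁ P₂ : Type) (_ : AddCommGroup P₀) (_ : Module A P₀)
      (_ : AddCommGroup P₁) (_ : Module A P₁) (_ : AddCommGroup P₂) (_ : Module A P₂)
      (d₂ : P₂ →ₗ[A] P₁) (d₁ : P₁ →ₗ[A] P₀) (π : P₀ →ₗ[A] M),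
      Module.Projective A P₀ ∧ Function.Surjective π ∧ Function.Exact d₁ π ∧
      Function.Exact d₂ d₁ ∧
      (Subsingleton (((Ext R (ModuleCat.{0} A) 1).obj
          (Opposite.op (ModuleCat.of A M))).obj (ModuleCat.of A N)) ↔
        ∀ φ : P₁ →ₗ[A] N, φ ∘ₗ d₂ = 0 → ∃ ψ : P₀ →ₗ[A] N, ψ ∘ₗ d₁ = φ) := by
  obtain ⟨P⟩ := (inferInstance : HasProjectiveResolution (ModuleCat.of A M)).out
  refine ⟨P.complex.X 0, P.complex.X 1, P.complex.X 2, inferInstance, inferInstance,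
    inferInstance, inferInstance, inferInstance, inferInstance,
    (P.complex.d 2 1).hom, (P.complex.d 1 0).hom, (P.π.f 0).hom, ?_, ?_, ?_, ?_, ?_⟩
  · exact (IsProjective.iff_projective _).2 (P.projective 0)
  · exact (ModuleCat.epi_iff_surjective (P.π.f 0)).1 inferInstance
  · exact (ShortComplex.ShortExact.moduleCat_exact_iff_function_exact _).1 P.exact₀
  · exact (ShortComplex.ShortExact.moduleCat_exact_iff_function_exact _).1 (P.exact_succ 0)
  · rw [ext1_iff_res R A _ _ P]
    constructor
    · intro h φ hφ
      obtain ⟨ψ, hψ⟩ := h (ModuleCat.ofHom φ) (by ext1; exact hφ)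
      exact ⟨ψ.hom, by rw [← ModuleCat.hom_comp, hψ]; rfl⟩
    · intro h φ hφ
      obtain ⟨ψ, hψ⟩ := h φ.hom (by rw [← ModuleCat.hom_comp, hφ]; rfl)
      exact ⟨ModuleCat.ofHom ψ, by ext1; exact hψ⟩

theorem exists_factor {A M N L : Type} [Ring A] [AddCommGroup M] [Module A M] [AddCommGroup N]
    [Module A N] [AddCommGroup L] [Module A L] (p : M →ₗ[A] N) (hp : Function.Surjective p)
    (f : M →ₗ[A] L) (h : ∀ x, p x = 0 → f x = 0) : ∃ g : N →ₗ[A] L, ∀ x, g (p x) = f x := by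
  refine ⟨((LinearMap.ker p).liftQ f (fun x hx => h x hx)) ∘ₗ
    (p.quotKerEquivOfSurjective hp).symm.toLinearMap, fun x => ?_⟩
  have : (p.quotKerEquivOfSurjective hp).symm (p x) = (LinearMap.ker p).mkQ x := by
    rw [LinearEquiv.symm_apply_eq]; rfl
  rw [LinearMap.comp_apply, LinearEquiv.coe_coe, this]
  rfl

theorem extend_of_ext (R : Type) [Ring R] (A : Type) [Ring A] [Linear R (ModuleCat.{0} A)]
    (M N K E : Type) [AddCommGroup M] [Module A M] [AddCommGroup N] [Module A N]
    [AddCommGroup K] [Module A K] [AddCommGroup E] [Module A E]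
    (h : Subsingleton (((Ext R (ModuleCat.{0} A) 1).obj
          (Opposite.op (ModuleCat.of A M))).obj (ModuleCat.of A N)))
    (μ : K →ₗ[A] E) (ε : E →ₗ[A] M) (hμ : Function.Injective μ) (hε : Function.Surjective ε)
    (hex : Function.Exact μ ε) (f : K →ₗ[A] N) : ∃ g : E →ₗ[A] N, g ∘ₗ μ = f := by
  obtain ⟨P₀, P₁, P₂, _, _, _, _, _, _, d₂, d₁, π, hP, hπ, h1, h2, hiff⟩ := ext1_data R A M N
  obtain ⟨a, ha⟩ := Module.projective_lifting_property ε π hε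
  have ha' : ∀ x, ε (a x) = π x := fun x => LinearMap.congr_fun ha x
  have hb : ∀ x, a (d₁ x) ∈ LinearMap.range μ := fun x => by
    have := (hex (a (d₁ x))).1 (by rw [ha']; exact h1.apply_apply_eq_zero x)
    simpa using this
  let b : P₁ →ₗ[A] K := (LinearEquiv.ofInjective μ hμ).symm.toLinearMap ∘ₗ
    (a ∘ₗ d₁).codRestrict (LinearMap.range μ) hb
  have hb' : ∀ x, μ (b x) = a (d₁ x) := fun x => by
    have := LinearEquiv.apply_symm_apply (LinearEquiv.ofInjective μ hμ)
      ((a ∘ₗ d₁).codRestrict (LinearMap.range μ) hb x)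
    exact congrArg Subtype.val this
  obtain ⟨ψ, hψ⟩ := hiff.1 h (f ∘ₗ b) (by
    ext x
    have : b (d₂ x) = 0 := hμ (by rw [hb', h2.apply_apply_eq_zero, map_zero, map_zero])
    simp [this])
  have hψ' : ∀ x, ψ (d₁ x) = f (b x) := fun x => LinearMap.congr_fun hψ x
  obtain ⟨g, hg⟩ := exists_factor (a.coprod μ) (by
    intro e
    obtain ⟨p, hp⟩ := hπ (ε e)
    obtain ⟨y, hy⟩ := (hex (e - a p)).1 (by rw [map_sub, ha', hp, sub_self])
    exact ⟨(p, y), by simp [hy]⟩) (ψ.coprod f) (by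
    rintro ⟨p, y⟩ h
    simp only [LinearMap.coprod_apply] at h ⊢
    have hp : π p = 0 := by
      have := congrArg ε h
      rwa [map_add, ha', hex.apply_apply_eq_zero, add_zero, map_zero] at this
    obtain ⟨q, rfl⟩ := (h1 p).1 hp
    rw [← hb', ← map_add] at h
    rw [hψ', ← map_add, hμ (h.trans (map_zero μ).symm), map_zero])
  refine ⟨g, ?_⟩
  ext y
  simpa using hg (0, y)

theorem ext_of_extend (R : Type) [Ring R] (A : Type) [Ring A] [Linear R (ModuleCat.{0} A)]
    (M N K E : Type) [AddCommGroup M] [Module A M] [AddCommGroup N] [Module A N]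
    [AddCommGroup K] [Module A K] [AddCommGroup E] [Module A E] [Module.Projective A E]
    (μ : K →ₗ[A] E) (ε : E →ₗ[A] M) (hε : Function.Surjective ε)
    (hex : Function.Exact μ ε)
    (h : ∀ f : K →ₗ[A] N, ∃ g : E →ₗ[A] N, g ∘ₗ μ = f) :
    Subsingleton (((Ext R (ModuleCat.{0} A) 1).obj
          (Opposite.op (ModuleCat.of A M))).obj (ModuleCat.of A N)) := by
  obtain ⟨P₀, P₁, P₂, _, _, _, _, _, _, d₂, d₁, π, hP, hπ, h1, h2, hiff⟩ := ext1_data R A M N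
  rw [hiff]
  intro φ hφ
  obtain ⟨c, hc⟩ := Module.projective_lifting_property ε π hε
  obtain ⟨a, ha⟩ := Module.projective_lifting_property π ε hπ
  have hc' : ∀ x, ε (c x) = π x := fun x => LinearMap.congr_fun hc x
  have ha' : ∀ x, π (a x) = ε x := fun x => LinearMap.congr_fun ha x
  -- the map induced on the image of `d₁`
  obtain ⟨φ', hφ'⟩ : ∃ φ' : LinearMap.ker π →ₗ[A] N,
      ∀ x (hx : d₁ x ∈ LinearMap.ker π), φ' ⟨d₁ x, hx⟩ = φ x := by
    obtain ⟨g, hg⟩ := exists_factor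
      (d₁.codRestrict (LinearMap.ker π) (fun x => h1.apply_apply_eq_zero x)) (by
      rintro ⟨y, hy⟩
      obtain ⟨x, rfl⟩ := (h1 y).1 hy
      exact ⟨x, rfl⟩) φ (by
      intro x hx
      obtain ⟨z, rfl⟩ := (h2 x).1 (congrArg Subtype.val hx)
      exact LinearMap.congr_fun hφ z)
    exact ⟨g, fun x hx => hg x⟩
  obtain ⟨χ, hχ⟩ := h (φ' ∘ₗ (a ∘ₗ μ).codRestrict (LinearMap.ker π) (fun x => by
    simp [ha', hex.apply_apply_eq_zero]))
  refine ⟨χ ∘ₗ c + φ' ∘ₗ (LinearMap.id - a ∘ₗ c).codRestrict (LinearMap.ker π) (fun x => by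
    simp [ha', hc']), ?_⟩
  ext x
  have hx : π (d₁ x) = 0 := h1.apply_apply_eq_zero x
  obtain ⟨y, hy⟩ := (hex (c (d₁ x))).1 (by rw [hc', hx])
  have e1 : χ (c (d₁ x)) = φ' ⟨a (c (d₁ x)), by simp [ha', hc', hx]⟩ := by
    have := LinearMap.congr_fun hχ y
    rw [LinearMap.comp_apply, hy] at this
    rw [this, LinearMap.comp_apply]
    congr 1
    ext
    simp [hy]
  rw [← hφ' x hx]
  simp only [LinearMap.comp_apply, LinearMap.add_apply, e1]
  rw [← map_add]
  congr 1
  ext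
  simp

section AddLemmas

variable {A : Type} [Ring A] {V W C D T N : Type} [AddCommGroup V] [Module A V]
  [AddCommGroup W] [Module A W] [AddCommGroup C] [Module A C] [AddCommGroup D] [Module A D]
  [AddCommGroup T] [Module A T] [AddCommGroup N] [Module A N]

theorem inAdd_of_fintype (ι : Type) [Fintype ι] (i : C →ₗ[A] (ι → V)) (p : (ι → V) →ₗ[A] C)
    (h : p ∘ₗ i = LinearMap.id) : InAdd A V C := by
  let e := LinearEquiv.funCongrLeft A V (Fintype.equivFin ι)
  refine ⟨Fintype.card ι, e.symm.toLinearMap ∘ₗ i, p ∘ₗ e.toLinearMap, ?_⟩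
  ext x
  simpa using LinearMap.congr_fun h x

theorem inAdd_retract (s : D →ₗ[A] C) (r : C →ₗ[A] D) (hr : r ∘ₗ s = LinearMap.id)
    (h : InAdd A V C) : InAdd A V D := by
  obtain ⟨n, i, p, hp⟩ := h
  refine ⟨n, i ∘ₗ s, r ∘ₗ p, ?_⟩
  ext x
  have h1 : p (i (s x)) = s x := LinearMap.congr_fun hp (s x)
  have h2 : r (s x) = x := LinearMap.congr_fun hr x
  simp [h1, h2]

theorem inAdd_self : InAdd A V V :=
  inAdd_of_fintype Unit (LinearMap.pi fun _ => LinearMap.id) (LinearMap.proj ()) (by ext x; rfl)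

theorem inAdd_prod (h : InAdd A V C) (h' : InAdd A V D) : InAdd A V (C × D) := by
  obtain ⟨n, i, p, hp⟩ := h
  obtain ⟨m, j, q, hq⟩ := h'
  let e := LinearEquiv.sumArrowLequivProdArrow (Fin n) (Fin m) A V
  refine inAdd_of_fintype (Fin n ⊕ Fin m) (e.symm.toLinearMap ∘ₗ (i.prodMap j))
    ((p.prodMap q) ∘ₗ e.toLinearMap) ?_
  apply LinearMap.ext
  rintro ⟨x, y⟩
  have h1 : p (i x) = x := LinearMap.congr_fun hp x
  have h2 : q (j y) = y := LinearMap.congr_fun hq y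
  simp [h1, h2]

theorem inAdd_base (s : V →ₗ[A] W) (r : W →ₗ[A] V) (hr : r ∘ₗ s = LinearMap.id)
    (h : InAdd A V C) : InAdd A W C := by
  obtain ⟨n, i, p, hp⟩ := h
  refine ⟨n, s.compLeft (Fin n) ∘ₗ i, p ∘ₗ r.compLeft (Fin n), ?_⟩
  ext x
  have h1 : r.compLeft (Fin n) (s.compLeft (Fin n) (i x)) = i x := by
    ext j
    exact LinearMap.congr_fun hr (i x j)
  have := LinearMap.congr_fun hp x
  simp only [LinearMap.comp_apply, h1]
  exact this

theorem inAdd_hom (T : Type) [AddCommGroup T] [Module A T] (h : InAdd A V C) :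
    InAdd (Module.End A T) (V →ₗ[A] T) (C →ₗ[A] T) := by
  obtain ⟨n, i, p, hp⟩ := h
  refine ⟨n, LinearMap.pi fun j => homPrecomp A (p ∘ₗ LinearMap.single A (fun _ => V) j),
    ∑ j, homPrecomp A (LinearMap.proj j ∘ₗ i) ∘ₗ LinearMap.proj j, ?_⟩
  apply LinearMap.ext
  intro f
  apply LinearMap.ext
  intro x
  have h1 : p (i x) = x := LinearMap.congr_fun hp x
  simp only [LinearMap.comp_apply, LinearMap.sum_apply, LinearMap.proj_apply, LinearMap.pi_apply,
    homPrecomp, LinearMap.coe_mk, AddHom.coe_mk, LinearMap.id_apply]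
  rw [← map_sum, ← map_sum]
  conv_rhs => rw [← h1]
  congr 2
  exact LinearMap.sum_single_apply (fun _ => V) (i x)

theorem projective_of_inAdd (h : InAdd A T C) :
    Module.Projective (Module.End A T) (C →ₗ[A] T) := by
  obtain ⟨n, i, p, hp⟩ := inAdd_hom T h
  have : Module.Projective (Module.End A T) (T →ₗ[A] T) :=
    (inferInstance : Module.Projective (Module.End A T) (Module.End A T))
  exact Module.Projective.of_split i p hp

theorem yoneda_add (h : InAdd A T C) (φ : (C →ₗ[A] T) →ₗ[Module.End A T] (N →ₗ[A] T)) :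
    ∃ g : N →ₗ[A] C, φ = homPrecomp A g := by
  obtain ⟨n, i, p, hp⟩ := h
  refine ⟨p ∘ₗ LinearMap.pi fun j => φ (LinearMap.proj j ∘ₗ i), ?_⟩
  apply LinearMap.ext
  intro f
  have hf : f = ∑ j, (show Module.End A T from f ∘ₗ p ∘ₗ LinearMap.single A (fun _ => T) j) •
      (LinearMap.proj j ∘ₗ i : C →ₗ[A] T) := by
    apply LinearMap.ext
    intro x
    have h1 : p (i x) = x := LinearMap.congr_fun hp x
    rw [LinearMap.sum_apply]
    change f x = ∑ j, f (p (LinearMap.single A (fun _ => T) j (i x j)))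
    rw [← map_sum, ← map_sum]
    conv_lhs => rw [← h1]
    congr 2
    exact (LinearMap.sum_single_apply (fun _ => T) (i x)).symm
  conv_lhs => rw [hf]
  rw [map_sum]
  apply LinearMap.ext
  intro x
  simp only [map_smul]
  rw [LinearMap.sum_apply]
  change ∑ j, f (p (LinearMap.single A (fun _ => T) j (φ (LinearMap.proj j ∘ₗ i) x))) =
    f (p ((LinearMap.pi fun j => φ (LinearMap.proj j ∘ₗ i)) x))
  rw [← map_sum, ← map_sum]
  congr 2
  exact (LinearMap.sum_single_apply (fun _ => T)
    ((LinearMap.pi fun j => φ (LinearMap.proj j ∘ₗ i)) x))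

end AddLemmas

/-- Koga's lemma: if `T = U ⊕ X` with `X` indecomposable, `X ∉ add U`,
`Ext^i_A(T,T) = 0` for all `i ≥ 1`, and `0 → Y → E → X → 0` is exact with
`ε : E → X` a right `add U`-approximation, then `M = Hom_A(U ⊕ Y, T)` is a tilting
module over `B = End_A(T)` of projective dimension exactly one. -/
theorem hom_mutation_isTilting
    (k : Type) [Field k] [IsAlgClosed k]
    (A : Type) [Ring A] [Algebra k A] [FiniteDimensional k A]
    (U X Y E : Type)
    [AddCommGroup U] [Module A U] [Module.Finite A U]
    [AddCommGroup X] [Module A X] [Module.Finite A X]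
    [AddCommGroup Y] [Module A Y] [Module.Finite A Y]
    [AddCommGroup E] [Module A E] [Module.Finite A E]
    (hX : IsIndecomposableModule A X)
    (hXU : ¬ InAdd A U X)
    (hext : ExtSelfVanish k A (U × X))
    (μ : Y →ₗ[A] E) (ε : E →ₗ[A] X)
    (hμ : Function.Injective μ) (hε : Function.Surjective ε)
    (hexact : LinearMap.range μ = LinearMap.ker ε)
    (happrox : IsRightAddApprox A U ε) :
    IsTiltingOfProjDimOne (Module.End A (U × X)) ((U × Y) →ₗ[A] (U × X)) := by
  have hex : Function.Exact μ ε := (LinearMap.exact_iff).2 hexact.symm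
  -- every map out of `Y` into `U × X` extends to `E`
  have hextend : ∀ f : Y →ₗ[A] (U × X), ∃ g : E →ₗ[A] (U × X), g ∘ₗ μ = f := by
    intro f
    obtain ⟨g, hg⟩ := extend_of_ext k A (U × X) (U × X) Y (U × E) (hext 1 le_rfl)
      (LinearMap.inr A U E ∘ₗ μ) (LinearMap.prodMap LinearMap.id ε)
      (LinearMap.inr_injective.comp hμ)
      (by
        rintro ⟨u, x⟩
        obtain ⟨e, rfl⟩ := hε x
        exact ⟨(u, e), rfl⟩)
      (by
        rintro ⟨u, e⟩
        constructor
        · intro h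
          have hu : u = 0 := congrArg Prod.fst h
          have he : ε e = 0 := congrArg Prod.snd h
          obtain ⟨y, rfl⟩ := (hex e).1 he
          exact ⟨y, by simp [hu]⟩
        · rintro ⟨y, hy⟩
          have hu : 0 = u := congrArg Prod.fst hy
          have he : μ y = e := congrArg Prod.snd hy
          rw [← hu, ← he]
          simp [hex.apply_apply_eq_zero]) f
    exact ⟨g ∘ₗ LinearMap.inr A U E, hg⟩
  obtain ⟨hEU, happ⟩ := happrox
  -- membership facts
  have hUT : InAdd A (U × X) U := inAdd_retract (LinearMap.inl A U X) (LinearMap.fst A U X)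
    (by ext; rfl) inAdd_self
  have hXT : InAdd A (U × X) X := inAdd_retract (LinearMap.inr A U X) (LinearMap.snd A U X)
    (by ext; rfl) inAdd_self
  have hET : InAdd A (U × X) E := inAdd_base (LinearMap.inl A U X) (LinearMap.fst A U X)
    (by ext; rfl) hEU
  have hUET : InAdd A (U × X) (U × E) := inAdd_prod hUT hET
  have hUEU : InAdd A U (U × E) := inAdd_prod inAdd_self hEU
  have hUEY : InAdd A (U × Y) (U × E) := inAdd_base (LinearMap.inl A U Y) (LinearMap.fst A U Y)
    (by ext; rfl) hUEU
  have hYY : InAdd A (U × Y) Y := inAdd_retract (LinearMap.inr A U Y) (LinearMap.snd A U Y)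
    (by ext; rfl) inAdd_self
  -- the projective resolution
  have hP₀ : Module.Projective (Module.End A (U × X)) ((U × E) →ₗ[A] (U × X)) :=
    projective_of_inAdd hUET
  have hP₁ : Module.Projective (Module.End A (U × X)) (X →ₗ[A] (U × X)) :=
    projective_of_inAdd hXT
  let ε' : (U × E) →ₗ[A] X := ε ∘ₗ LinearMap.snd A U E
  have hε' : Function.Surjective ε' := hε.comp Prod.snd_surjective
  let μ' : (U × Y) →ₗ[A] (U × E) := LinearMap.prodMap LinearMap.id μ
  let ι : (X →ₗ[A] (U × X)) →ₗ[Module.End A (U × X)] ((U × E) →ₗ[A] (U × X)) := homPrecomp A ε'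
  let π : ((U × E) →ₗ[A] (U × X)) →ₗ[Module.End A (U × X)] ((U × Y) →ₗ[A] (U × X)) :=
    homPrecomp A μ'
  have hι : Function.Injective ι := by
    intro f g hfg
    apply LinearMap.ext
    intro x
    obtain ⟨z, rfl⟩ := hε' x
    exact LinearMap.congr_fun hfg z
  have hπ : Function.Surjective π := by
    intro f
    obtain ⟨g, hg⟩ := hextend (f ∘ₗ LinearMap.inr A U Y)
    refine ⟨(f ∘ₗ LinearMap.inl A U Y).coprod g, ?_⟩
    apply LinearMap.ext
    rintro ⟨u, y⟩
    have hgy : g (μ y) = f (0, y) := LinearMap.congr_fun hg y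
    change f (u, 0) + g (μ y) = f (u, y)
    rw [hgy, ← map_add]
    simp
  have hιπ : Function.Exact ι π := by
    intro f
    constructor
    · intro hf
      obtain ⟨g, hg⟩ := exists_factor ε' hε' f (by
        rintro ⟨u, e⟩ he
        obtain ⟨y, rfl⟩ := (hex e).1 he
        exact LinearMap.congr_fun hf (u, y))
      exact ⟨g, LinearMap.ext hg⟩
    · rintro ⟨g, rfl⟩
      apply LinearMap.ext
      rintro ⟨u, y⟩
      change g (ε (μ y)) = 0
      rw [hex.apply_apply_eq_zero, map_zero]
  refine ⟨⟨⟨_, _, _, _, _, _, hP₀, hP₁, ι, π, hι, hπ, (LinearMap.exact_iff.1 hιπ).symm⟩, ?_⟩,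
    ?_, ?_⟩
  · -- not projective
    intro hM
    obtain ⟨σ, hσ⟩ := Module.projective_lifting_property π LinearMap.id hπ
    have htfae := hιπ.split_tfae'.out 0 1
    obtain ⟨-, r, hr⟩ := htfae.1 ⟨hι, σ, hσ⟩
    obtain ⟨s, hs⟩ := yoneda_add hUET r
    apply hXU
    refine inAdd_retract s ε' ?_ hUEU
    have h1 := LinearMap.congr_fun hr (LinearMap.inr A U X)
    rw [hs] at h1
    apply LinearMap.ext
    intro x
    exact congrArg Prod.snd (LinearMap.congr_fun h1 x)
  · -- rigidity
    refine ext_of_extend ℤ (Module.End A (U × X)) _ _ _ _ ι π hπ hιπ ?_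
    intro φ
    obtain ⟨g, rfl⟩ := yoneda_add hXT φ
    obtain ⟨a, ha⟩ := happ U inAdd_self (g ∘ₗ LinearMap.inl A U Y)
    obtain ⟨b, hb⟩ := hextend (LinearMap.inr A U X ∘ₗ g ∘ₗ LinearMap.inr A U Y)
    obtain ⟨c, hc⟩ := happ E hEU (LinearMap.snd A U X ∘ₗ b)
    refine ⟨homPrecomp A (LinearMap.inr A U E ∘ₗ a.coprod (c ∘ₗ μ)), ?_⟩
    apply LinearMap.ext
    intro f
    apply LinearMap.ext
    rintro ⟨u, y⟩
    have h1 : ε (a u) = g (u, 0) := LinearMap.congr_fun ha u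
    have h2 : ε (c (μ y)) = (b (μ y)).2 := LinearMap.congr_fun hc (μ y)
    have h3 : b (μ y) = (0, g (0, y)) := LinearMap.congr_fun hb y
    change f (ε (a u + c (μ y))) = f (g (u, y))
    rw [map_add, h1, h2, h3, ← map_add]
    simp
  · -- the coresolution of `B`
    let f : Module.End A (U × X) →ₗ[Module.End A (U × X)] ((U × E) →ₗ[A] (U × X)) :=
      homPrecomp (T := U × X) A (LinearMap.prodMap LinearMap.id ε : (U × E) →ₗ[A] (U × X))
    let g : ((U × E) →ₗ[A] (U × X)) →ₗ[Module.End A (U × X)] (Y →ₗ[A] (U × X)) :=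
      homPrecomp A (LinearMap.inr A U E ∘ₗ μ)
    have hsurj : Function.Surjective
        (LinearMap.prodMap LinearMap.id ε : (U × E) →ₗ[A] (U × X)) := by
      rintro ⟨u, x⟩
      obtain ⟨e, rfl⟩ := hε x
      exact ⟨(u, e), rfl⟩
    refine ⟨_, _, _, _, _, _, inAdd_hom (U × X) hUEY, inAdd_hom (U × X) hYY, f, g, ?_, ?_, ?_⟩
    · intro a b hab
      apply LinearMap.ext
      intro x
      obtain ⟨z, rfl⟩ := hsurj x
      exact LinearMap.congr_fun hab z
    · intro h
      obtain ⟨b, hb⟩ := hextend h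
      exact ⟨b ∘ₗ LinearMap.snd A U E, hb⟩
    · ext h
      constructor
      · rintro ⟨b, rfl⟩
        apply LinearMap.ext
        intro y
        change b (0, ε (μ y)) = 0
        rw [hex.apply_apply_eq_zero]
        exact map_zero b
      · intro hh
        obtain ⟨b, hb⟩ := exists_factor _ hsurj h (by
          rintro ⟨u, e⟩ he
          have hu : u = 0 := congrArg Prod.fst he
          obtain ⟨y, rfl⟩ := (hex e).1 (congrArg Prod.snd he)
          rw [hu]
          exact LinearMap.congr_fun hh y)
        exact ⟨b, LinearMap.ext hb⟩
end
end

section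
/- Let k be an algebraically closed field, A a finite-dimensional k-algebra, and T = U ⊕ X a basic semi-tilting left A-module with X indecomposable and X ∈ gen U. Then there exists a short exact sequence 0 → Y →μ→ E →ε→ X → 0 of finite-dimensional left A-modules in which ε : E → X is a minimal right add U-approximation of X, and for any such sequence the module T' = U ⊕ Y is again a basic semi-tilting A-module. -/
open CategoryTheory

noncomputable section

theorem ext_bridge (k : Type) [Field k] (A : Type) [Ring A] [Algebra k A]
   (M N : ModuleCat.{0} A) (i : ℕ) :
   Subsingleton (((Ext k (ModuleCat.{0} A) (i+1)).obj (Opposite.op M)).obj N) ↔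
   Subsingleton (Abelian.Ext M N (i+1)) := by
  let P := projectiveResolution M
  have h1 : Subsingleton (((Ext k (ModuleCat.{0} A) (i+1)).obj (Opposite.op M)).obj N) ↔
    (P.complex.linearYonedaObj k N).ExactAt (i+1) := by
    rw [HomologicalComplex.exactAt_iff_isZero_homology, ← ModuleCat.isZero_iff_subsingleton]
    exact (P.isoExt (R := k) (i+1) N).isZero_iff
  have h2 : (P.complex.linearYonedaObj k N).ExactAt (i+1) ↔ 
     ∀ f : P.complex.X (i+1) ⟶ N, P.complex.d (i+2) (i+1) ≫ f = 0 → 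
      ∃ g : P.complex.X i ⟶ N, P.complex.d (i+1) i ≫ g = f := by
    rw [HomologicalComplex.exactAt_iff' _ i (i+1) (i+2) (by simp) (by simp), ShortComplex.moduleCat_exact_iff]
    rfl
  have h3 : Subsingleton (Abelian.Ext M N (i+1)) ↔ ∀ f : P.complex.X (i+1) ⟶ N, P.complex.d (i+2) (i+1) ≫ f = 0 → 
      ∃ g : P.complex.X i ⟶ N, P.complex.d (i+1) i ≫ g = f := by
    constructor
    · intro h f hf
      exact (P.extMk_eq_zero_iff f (i+2) rfl hf i rfl).1 (Subsingleton.elim _ _)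
    · intro h
      refine ⟨fun a b => ?_⟩
      suffices ∀ a : Abelian.Ext M N (i+1), a = 0 by rw [this a, this b]
      intro a
      obtain ⟨f, hf, rfl⟩ := P.extMk_surjective a (i+2) rfl
      exact (P.extMk_eq_zero_iff f (i+2) rfl hf i rfl).2 (h f hf)
  rw [h1, h2, h3]

/-- vanishing of Ext -/
def EV (A : Type) [Ring A] (M N : Type) [AddCommGroup M] [Module A M]
    [AddCommGroup N] [Module A N] (i : ℕ) : Prop :=
  Subsingleton (Abelian.Ext (ModuleCat.of A M) (ModuleCat.of A N) i)

section EVsec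

variable {A : Type} [Ring A] {M N M' L Q W : Type} [AddCommGroup M] [Module A M]
  [AddCommGroup N] [Module A N] [AddCommGroup M'] [Module A M'] [AddCommGroup L] [Module A L]
  [AddCommGroup Q] [Module A Q] [AddCommGroup W] [Module A W]

theorem EV.zero {i : ℕ} (h : EV A M N i) (x : Abelian.Ext (ModuleCat.of A M) (ModuleCat.of A N) i) :
    x = 0 := by
  unfold EV at h
  exact Subsingleton.elim _ _

theorem EV.of_zero {i : ℕ}
    (h : ∀ x : Abelian.Ext (ModuleCat.of A M) (ModuleCat.of A N) i, x = 0) : EV A M N i :=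
  ⟨fun a b => by rw [h a, h b]⟩

theorem InAdd.sum (h : InAdd A M M') : ∃ (n : ℕ) (f : Fin n → (M' →ₗ[A] M))
    (g : Fin n → (M →ₗ[A] M')), ∑ j, g j ∘ₗ f j = LinearMap.id := by
  obtain ⟨n, i, p, hp⟩ := h
  refine ⟨n, fun j => LinearMap.proj j ∘ₗ i, fun j => p ∘ₗ LinearMap.single A (fun _ => M) j, ?_⟩
  rw [← hp]
  ext x
  simp only [LinearMap.coe_sum, Finset.sum_apply, LinearMap.comp_apply, LinearMap.proj_apply]
  rw [← map_sum]
  congr 1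
  exact LinearMap.sum_single_apply (fun _ => M) (i x)

theorem InAdd.of_sum {n : ℕ} (f : Fin n → (M' →ₗ[A] M))
    (g : Fin n → (M →ₗ[A] M')) (h : ∑ j, g j ∘ₗ f j = LinearMap.id) : InAdd A M M' := by
  refine ⟨n, LinearMap.pi f, ∑ j, g j ∘ₗ LinearMap.proj j, ?_⟩
  rw [← h]
  ext x
  simp

theorem sum_cat {n : ℕ} (f : Fin n → (M' →ₗ[A] M))
    (g : Fin n → (M →ₗ[A] M')) (h : ∑ j, g j ∘ₗ f j = LinearMap.id) :
    ∑ j, ModuleCat.ofHom (f j) ≫ ModuleCat.ofHom (g j) = 𝟙 (ModuleCat.of A M') := by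
  ext x
  have := LinearMap.congr_fun h x
  simpa [ModuleCat.hom_sum] using this

theorem EV.left {i : ℕ} (h : EV A M N i) (hM : InAdd A M M') : EV A M' N i := by
  obtain ⟨n, f, g, hfg⟩ := hM.sum
  apply EV.of_zero
  intro x
  have : (Abelian.Ext.mk₀ (𝟙 (ModuleCat.of A M'))).comp x (zero_add i) = x := by simp
  rw [← this, ← sum_cat f g hfg, Abelian.Ext.mk₀_sum, Abelian.Ext.sum_comp]
  apply Finset.sum_eq_zero
  intro j _
  rw [← Abelian.Ext.mk₀_comp_mk₀, Abelian.Ext.comp_assoc_of_second_deg_zero, h.zero ((Abelian.Ext.mk₀ (ModuleCat.ofHom (g j))).comp x (zero_add i))]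
  simp

theorem EV.right {i : ℕ} (h : EV A N M i) (hM : InAdd A M M') : EV A N M' i := by
  obtain ⟨n, f, g, hfg⟩ := hM.sum
  apply EV.of_zero
  intro x
  have : x.comp (Abelian.Ext.mk₀ (𝟙 (ModuleCat.of A M'))) (add_zero i) = x := by simp
  rw [← this, ← sum_cat f g hfg, Abelian.Ext.mk₀_sum, Abelian.Ext.comp_sum]
  apply Finset.sum_eq_zero
  intro j _
  rw [← Abelian.Ext.mk₀_comp_mk₀, ← Abelian.Ext.comp_assoc_of_second_deg_zero, h.zero (x.comp (Abelian.Ext.mk₀ (ModuleCat.ofHom (f j))) (add_zero i))]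
  simp

/-- short exactness -/
def SES (f : L →ₗ[A] M) (g : M →ₗ[A] Q) : Prop :=
  Function.Injective f ∧ Function.Surjective g ∧ LinearMap.range f = LinearMap.ker g

theorem SES.comp {f : L →ₗ[A] M} {g : M →ₗ[A] Q} (h : SES f g) : g ∘ₗ f = 0 := by
  ext x
  have : f x ∈ LinearMap.ker g := h.2.2 ▸ LinearMap.mem_range_self f x
  simpa using this

/-- the short complex -/
def SES.S {f : L →ₗ[A] M} {g : M →ₗ[A] Q} (h : SES f g) : ShortComplex (ModuleCat.{0} A) :=
  ShortComplex.mk (ModuleCat.ofHom f) (ModuleCat.ofHom g) (by rw [← ModuleCat.ofHom_comp, h.comp]; rfl)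

theorem SES.exact {f : L →ₗ[A] M} {g : M →ₗ[A] Q} (h : SES f g) : h.S.ShortExact :=
  { exact := by
      rw [ShortComplex.moduleCat_exact_iff_range_eq_ker]
      exact h.2.2
    mono_f := (ModuleCat.mono_iff_injective _).2 h.1
    epi_g := (ModuleCat.epi_iff_surjective _).2 h.2.1 }

variable {f : L →ₗ[A] M} {g : M →ₗ[A] Q}

theorem SES.mid_left (h : SES f g) {i : ℕ} (h1 : EV A L N i) (h2 : EV A Q N i) : EV A M N i := by
  apply EV.of_zero
  intro x
  obtain ⟨y, rfl⟩ := Abelian.Ext.contravariant_sequence_exact₂ h.exact _ (x : Abelian.Ext h.S.X₂ _ i) (h1.zero _)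
  have hy := h2.zero y
  erw [hy]
  apply Abelian.Ext.comp_zero

theorem SES.mid_right (h : SES f g) {i : ℕ} (h1 : EV A N L i) (h2 : EV A N Q i) : EV A N M i := by
  apply EV.of_zero
  intro x
  obtain ⟨y, rfl⟩ := Abelian.Ext.covariant_sequence_exact₂ _ h.exact (x : Abelian.Ext _ h.S.X₂ i) (h2.zero _)
  have hy := h1.zero y
  erw [hy]
  apply Abelian.Ext.zero_comp

theorem SES.sub_left (h : SES f g) {i : ℕ} (h1 : EV A M N i) (h2 : EV A Q N (i+1)) : EV A L N i := by
  apply EV.of_zero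
  intro x
  obtain ⟨y, rfl⟩ := Abelian.Ext.contravariant_sequence_exact₁ h.exact _ (x : Abelian.Ext h.S.X₁ _ i) (add_comm 1 i) (h2.zero _)
  have hy := h1.zero y
  erw [hy]
  apply Abelian.Ext.comp_zero

theorem SES.sub_right (h : SES f g) {i : ℕ} (h1 : EV A N M (i+1)) (h2 : EV A N Q i) : EV A N L (i+1) := by
  apply EV.of_zero
  intro x
  obtain ⟨y, rfl⟩ := Abelian.Ext.covariant_sequence_exact₁ _ h.exact (x : Abelian.Ext _ h.S.X₁ (i+1)) (h1.zero _) rfl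
  have hy := h2.zero y
  erw [hy]
  apply Abelian.Ext.zero_comp

theorem SES.sub_right_one (h : SES f g) (h1 : EV A N M 1)
    (h2 : ∀ a : N →ₗ[A] Q, ∃ b : N →ₗ[A] M, g ∘ₗ b = a) : EV A N L 1 := by
  apply EV.of_zero
  intro x
  obtain ⟨y, rfl⟩ := Abelian.Ext.covariant_sequence_exact₁ _ h.exact (x : Abelian.Ext _ h.S.X₁ 1) (h1.zero _) (zero_add 1)
  obtain ⟨a, rfl⟩ := Abelian.Ext.addEquiv₀.symm.surjective y
  obtain ⟨b, hb⟩ := h2 a.hom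
  let b' : ModuleCat.of A N ⟶ h.S.X₂ := ModuleCat.ofHom b
  have : a = b' ≫ h.S.g := by
    ext x
    exact (LinearMap.congr_fun hb x).symm
  rw [this]
  simp only [Abelian.Ext.addEquiv₀_symm_apply]
  rw [← Abelian.Ext.mk₀_comp_mk₀, Abelian.Ext.comp_assoc_of_second_deg_zero, ShortComplex.ShortExact.comp_extClass]
  apply Abelian.Ext.comp_zero

theorem SES.lift (h : SES f g) (h1 : EV A N L 1) (a : N →ₗ[A] Q) : ∃ b : N →ₗ[A] M, g ∘ₗ b = a := by
  obtain ⟨y, hy⟩ := Abelian.Ext.covariant_sequence_exact₃ _ h.exact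
    (Abelian.Ext.mk₀ (ModuleCat.ofHom a) : Abelian.Ext _ h.S.X₃ 0) (zero_add 1) (h1.zero _)
  obtain ⟨b, rfl⟩ := Abelian.Ext.addEquiv₀.symm.surjective y
  simp only [Abelian.Ext.addEquiv₀_symm_apply, Abelian.Ext.mk₀_comp_mk₀] at hy
  have := (Abelian.Ext.mk₀_bijective _ _).1 hy
  refine ⟨b.hom, ?_⟩
  exact congrArg ModuleCat.Hom.hom this

theorem SES.extend (h : SES f g) (h1 : EV A Q N 1) (a : L →ₗ[A] N) : ∃ b : M →ₗ[A] N, b ∘ₗ f = a := by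
  obtain ⟨y, hy⟩ := Abelian.Ext.contravariant_sequence_exact₁ h.exact _
    (Abelian.Ext.mk₀ (ModuleCat.ofHom a) : Abelian.Ext h.S.X₁ _ 0) (add_zero 1) (h1.zero _)
  obtain ⟨b, rfl⟩ := Abelian.Ext.addEquiv₀.symm.surjective y
  simp only [Abelian.Ext.addEquiv₀_symm_apply, Abelian.Ext.mk₀_comp_mk₀] at hy
  have := (Abelian.Ext.mk₀_bijective _ _).1 hy
  refine ⟨b.hom, ?_⟩
  exact congrArg ModuleCat.Hom.hom this

end EVsec

section Chain

variable {A : Type} [Ring A] {W M N M' L Q V : Type} [AddCommGroup M] [Module A M]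
  [AddCommGroup N] [Module A N] [AddCommGroup M'] [Module A M'] [AddCommGroup L] [Module A L]
  [AddCommGroup Q] [Module A Q] [AddCommGroup W] [Module A W] [AddCommGroup V] [Module A V]

theorem InAdd.retract (h : InAdd A W M) (i : N →ₗ[A] M) (p : M →ₗ[A] N)
    (hp : p ∘ₗ i = LinearMap.id) : InAdd A W N := by
  obtain ⟨n, a, b, hab⟩ := h
  refine ⟨n, a ∘ₗ i, p ∘ₗ b, ?_⟩
  ext x
  have h1 := LinearMap.congr_fun hab (i x)
  have h2 := LinearMap.congr_fun hp x
  simp at h1 h2 ⊢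
  rw [h1, h2]

theorem InAdd.refl : InAdd A W W :=
  InAdd.of_sum (n := 1) (fun _ => LinearMap.id) (fun _ => LinearMap.id) (by simp)

theorem InAdd.pi (h : InAdd A W M) (r : ℕ) : InAdd A W (Fin r → M) := by
  obtain ⟨n, a, b, hab⟩ := h
  let e := (LinearEquiv.funCongrLeft A W (finProdFinEquiv (m := r) (n := n))).trans
    (LinearEquiv.curry A W (Fin r) (Fin n))
  refine ⟨r * n, e.symm.toLinearMap ∘ₗ LinearMap.compLeft a (Fin r),
    LinearMap.compLeft b (Fin r) ∘ₗ e.toLinearMap, ?_⟩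
  ext x j
  simp only [LinearMap.comp_apply, LinearEquiv.coe_coe, LinearEquiv.apply_symm_apply]
  exact LinearMap.congr_fun hab _

theorem InAdd.trans (h : InAdd A W M) (h' : InAdd A M N) : InAdd A W N := by
  obtain ⟨n, a, b, hab⟩ := h'
  exact (h.pi n).retract a b hab

theorem InAdd.prod (h : InAdd A W M) (h' : InAdd A W N) : InAdd A W (M × N) := by
  obtain ⟨n, f, g, hfg⟩ := h.sum
  obtain ⟨m, f', g', hfg'⟩ := h'.sum
  refine InAdd.of_sum (n := n + m)
    (Fin.append (fun j => f j ∘ₗ LinearMap.fst A M N) (fun j => f' j ∘ₗ LinearMap.snd A M N))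
    (Fin.append (fun j => LinearMap.inl A M N ∘ₗ g j) (fun j => LinearMap.inr A M N ∘ₗ g' j)) ?_
  rw [Fin.sum_univ_add]
  apply LinearMap.ext
  rintro ⟨x, y⟩
  have h1 := LinearMap.congr_fun hfg x
  have h2 := LinearMap.congr_fun hfg' y
  simp at h1 h2
  simp [Prod.ext_iff, Prod.fst_sum, Prod.snd_sum, h1, h2]

theorem InAdd.equiv (h : InAdd A W M) (e : M ≃ₗ[A] N) : InAdd A W N :=
  h.retract e.symm.toLinearMap e.toLinearMap (by ext; simp)

theorem InAdd.left (U X : Type) [AddCommGroup U] [Module A U] [AddCommGroup X] [Module A X] :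
    InAdd A (U × X) U :=
  InAdd.refl.retract (LinearMap.inl A U X) (LinearMap.fst A U X) (by ext; simp)

theorem InAdd.right (U X : Type) [AddCommGroup U] [Module A U] [AddCommGroup X] [Module A X] :
    InAdd A (U × X) X :=
  InAdd.refl.retract (LinearMap.inr A U X) (LinearMap.snd A U X) (by ext; simp)

theorem InAdd.compl (h : InAdd A W M) : ∃ (n : ℕ) (N : Type) (_ : AddCommGroup N) (_ : Module A N),
    InAdd A W N ∧ Nonempty ((M × N) ≃ₗ[A] (Fin n → W)) := by
  obtain ⟨n, i, p, hp⟩ := h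
  have hp' : ∀ x, p (i x) = x := fun x => LinearMap.congr_fun hp x
  let q : (Fin n → W) →ₗ[A] LinearMap.ker p :=
    LinearMap.codRestrict _ (LinearMap.id - i ∘ₗ p) (by intro c; simp [hp'])
  refine ⟨n, LinearMap.ker p, inferInstance, inferInstance, ?_, ⟨?_⟩⟩
  · refine (InAdd.refl.pi n).retract (LinearMap.ker p).subtype q ?_
    ext x : 2
    have := x.2
    simp only [LinearMap.mem_ker] at this
    simp [q, this]
  · refine LinearEquiv.ofLinear (LinearMap.coprod i (LinearMap.ker p).subtype)
      (LinearMap.prod p q) ?_ ?_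
    · apply LinearMap.ext
      intro x
      simp [q]
    · apply LinearMap.ext
      rintro ⟨x, y⟩
      have := y.2
      simp only [LinearMap.mem_ker] at this
      simp [q, this, hp', Prod.ext_iff, Subtype.ext_iff]

theorem chain_iso {n : ℕ} (h : AddCoresChain A W n M) (e : M ≃ₗ[A] N) :
    AddCoresChain A W n N := by
  cases n with
  | zero => exact InAdd.equiv h e
  | succ n =>
    obtain ⟨T₀, _, _, f, hf, hT, hc⟩ := h
    refine ⟨T₀, _, _, f ∘ₗ e.symm.toLinearMap, by simpa using hf, hT, ?_⟩
    have : LinearMap.range (f ∘ₗ e.symm.toLinearMap) = LinearMap.range f := by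
      rw [LinearMap.range_comp]; simp
    rw [this]
    exact hc

theorem chain_cons {n : ℕ} {f : L →ₗ[A] M} {g : M →ₗ[A] Q} (h : SES f g) (hM : InAdd A W M)
    (hQ : AddCoresChain A W n Q) : AddCoresChain A W (n + 1) L := by
  refine ⟨M, _, _, f, h.1, hM, ?_⟩
  rw [h.2.2]
  exact chain_iso hQ (g.quotKerEquivOfSurjective h.2.1).symm

theorem chain_uncons {n : ℕ} (h : AddCoresChain A W (n+1) M) :
    ∃ (T₀ Z : Type) (_ : AddCommGroup T₀) (_ : Module A T₀) (_ : AddCommGroup Z) (_ : Module A Z)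
      (f : M →ₗ[A] T₀) (g : T₀ →ₗ[A] Z), SES f g ∧ InAdd A W T₀ ∧ AddCoresChain A W n Z := by
  obtain ⟨T₀, _, _, f, hf, hT, hc⟩ := h
  exact ⟨T₀, _, _, _, _, _, f, (LinearMap.range f).mkQ, ⟨hf, Submodule.mkQ_surjective _, by simp⟩,
    hT, hc⟩

theorem chain_ev (hW : ∀ i, EV A W W (i + 1)) {n : ℕ} : ∀ {M : Type} [AddCommGroup M] [Module A M],
    AddCoresChain A W n M → ∀ i, EV A M W (i + 1) := by
  induction n with
  | zero => intro M _ _ h i; exact (hW i).left h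
  | succ n ih =>
    intro M _ _ h i
    obtain ⟨T₀, Z, _, _, _, _, f, g, hs, hT, hc⟩ := chain_uncons h
    exact hs.sub_left ((hW i).left hT) (ih hc (i+1))

theorem chain_prod {n : ℕ} (h : AddCoresChain A W n M) (hV : InAdd A W V) :
    AddCoresChain A W n (M × V) := by
  cases n with
  | zero => exact InAdd.prod h hV
  | succ n =>
    obtain ⟨T₀, Z, _, _, _, _, f, g, hs, hT, hc⟩ := chain_uncons h
    refine chain_cons (f := LinearMap.prodMap f LinearMap.id) (g := g ∘ₗ LinearMap.fst A T₀ V)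
      ⟨?_, ?_, ?_⟩ (hT.prod hV) hc
    · exact hs.1.prodMap Function.injective_id
    · simpa using hs.2.1.comp Prod.fst_surjective
    · rw [LinearMap.range_prodMap, hs.2.2]
      ext ⟨x, y⟩
      simp

theorem chain_retract (hW : ∀ i, EV A W W (i + 1)) {n : ℕ} :
    ∀ {M M' : Type} [AddCommGroup M] [Module A M] [AddCommGroup M'] [Module A M'],
    AddCoresChain A W n M → ∀ (i : M' →ₗ[A] M) (p : M →ₗ[A] M'), p ∘ₗ i = LinearMap.id →
    AddCoresChain A W n M' := by
  induction n with
  | zero => intro M M' _ _ _ _ h i p hp; exact InAdd.retract h i p hp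
  | succ n ih =>
    intro M M' _ _ _ _ h i p hp
    have hp' : ∀ x, p (i x) = x := fun x => LinearMap.congr_fun hp x
    obtain ⟨T₀, Z, _, _, _, _, f, g, hs, hT, hc⟩ := chain_uncons h
    have hgf : ∀ x, g (f x) = 0 := fun x => LinearMap.congr_fun hs.comp x
    obtain ⟨φ, hφ⟩ := hs.extend ((chain_ev hW hc 0).right hT) (f ∘ₗ i ∘ₗ p)
    have hφ' : ∀ x, φ (f x) = f (i (p x)) := fun x => LinearMap.congr_fun hφ x
    have hinj : Function.Injective i := Function.LeftInverse.injective hp'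
    refine ⟨T₀, _, _, f ∘ₗ i, by simpa using hs.1.comp hinj, hT, ?_⟩
    set R := LinearMap.range (f ∘ₗ i) with hR
    -- map Z → T₀ ⧸ R
    have hk : LinearMap.ker g ≤ LinearMap.ker (R.mkQ ∘ₗ φ) := by
      rw [← hs.2.2]
      rintro _ ⟨x, rfl⟩
      simp only [LinearMap.mem_ker, LinearMap.comp_apply, Submodule.mkQ_apply,
        Submodule.Quotient.mk_eq_zero]
      rw [hφ']
      exact ⟨p x, rfl⟩
    let a : Z →ₗ[A] (T₀ ⧸ R) := (LinearMap.ker g).liftQ (R.mkQ ∘ₗ φ) hk ∘ₗ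
      (g.quotKerEquivOfSurjective hs.2.1).symm.toLinearMap
    have ha : ∀ t, a (g t) = R.mkQ (φ t) := by
      intro t
      have : (g.quotKerEquivOfSurjective hs.2.1).symm (g t) = (LinearMap.ker g).mkQ t := by
        rw [LinearEquiv.symm_apply_eq]; rfl
      simp [a, this]
    let b : (T₀ ⧸ R) →ₗ[A] Z := R.liftQ g (by
      rintro _ ⟨x, rfl⟩
      simp [hgf])
    let c : (T₀ ⧸ R) →ₗ[A] T₀ := R.liftQ (LinearMap.id - φ) (by
      rintro _ ⟨x, rfl⟩
      simp [hφ', hp'])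
    refine ih (chain_prod hc hT) (LinearMap.prod b c) (LinearMap.coprod a R.mkQ) ?_
    apply LinearMap.ext
    intro x
    obtain ⟨t, rfl⟩ := R.mkQ_surjective x
    have h1 : b (R.mkQ t) = g t := by simp [b]
    have h2 : c (R.mkQ t) = t - φ t := by simp [c]
    change a (b (R.mkQ t)) + R.mkQ (c (R.mkQ t)) = R.mkQ t
    rw [h1, h2, ha, map_sub]
    exact add_sub_cancel (R.mkQ (φ t)) (R.mkQ t)

end Chain

section Mutate

variable {A : Type} [Ring A] {U X Y E : Type} [AddCommGroup U] [Module A U]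
  [AddCommGroup X] [Module A X] [AddCommGroup Y] [Module A Y] [AddCommGroup E] [Module A E]

theorem base_ses {μ : Y →ₗ[A] E} {ε : E →ₗ[A] X} (hs : SES μ ε) (r : ℕ) :
    SES (LinearMap.compLeft (LinearMap.inr A U E ∘ₗ μ) (Fin r))
      (LinearMap.compLeft (LinearMap.prodMap (LinearMap.id : U →ₗ[A] U) ε) (Fin r)) := by
  refine ⟨?_, ?_, ?_⟩
  · intro x y h
    funext j
    have := congrArg Prod.snd (congrFun h j)
    exact hs.1 this
  · intro y
    choose e he using fun j => hs.2.1 (y j).2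
    refine ⟨fun j => ((y j).1, e j), ?_⟩
    funext j
    exact Prod.ext rfl (he j)
  · ext x
    simp only [LinearMap.mem_range, LinearMap.mem_ker]
    constructor
    · rintro ⟨y, rfl⟩
      funext j
      exact Prod.ext rfl (LinearMap.congr_fun hs.comp (y j))
    · intro h
      have h1 : ∀ j, (x j).1 = 0 := fun j => congrArg Prod.fst (congrFun h j)
      have h2 : ∀ j, ∃ y, μ y = (x j).2 := by
        intro j
        have : (x j).2 ∈ LinearMap.ker ε := congrArg Prod.snd (congrFun h j)
        rw [← hs.2.2] at this
        exact this
      choose y hy using h2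
      refine ⟨y, ?_⟩
      funext j
      exact Prod.ext (h1 j).symm (hy j)

/-- the zig-zag step, in abstract form -/
theorem step_ses {K T L V V' C C' : Type} [AddCommGroup K] [Module A K] [AddCommGroup T] [Module A T]
    [AddCommGroup L] [Module A L] [AddCommGroup V] [Module A V] [AddCommGroup V'] [Module A V']
    [AddCommGroup C] [Module A C] [AddCommGroup C'] [Module A C']
    {κ : K →ₗ[A] T} {θ : T →ₗ[A] L} (h : SES κ θ)
    {j : V →ₗ[A] C} {π : C →ₗ[A] L} (h1 : SES j π)
    {j' : V' →ₗ[A] C'} {ρ : C' →ₗ[A] T} (h2 : SES j' ρ)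
    (φ : C' →ₗ[A] C) (hφ : π ∘ₗ φ = θ ∘ₗ ρ) :
    ∃ (Q : Type) (_ : AddCommGroup Q) (_ : Module A Q) (a : V' →ₗ[A] Q) (b : Q →ₗ[A] K)
      (c : Q →ₗ[A] (C' × V)) (d : (C' × V) →ₗ[A] C), SES a b ∧ SES c d := by
  have hφ' : ∀ x, π (φ x) = θ (ρ x) := fun x => LinearMap.congr_fun hφ x
  have hπj : ∀ x, π (j x) = 0 := fun x => LinearMap.congr_fun h1.comp x
  have hρj : ∀ x, ρ (j' x) = 0 := fun x => LinearMap.congr_fun h2.comp x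
  have hθκ : ∀ x, θ (κ x) = 0 := fun x => LinearMap.congr_fun h.comp x
  have ex : ∀ t, θ t = 0 → ∃ x, κ x = t := by
    intro t ht
    have : t ∈ LinearMap.ker θ := ht
    rw [← h.2.2] at this; exact this
  have ex1 : ∀ t, π t = 0 → ∃ x, j x = t := by
    intro t ht
    have : t ∈ LinearMap.ker π := ht
    rw [← h1.2.2] at this; exact this
  have ex2 : ∀ t, ρ t = 0 → ∃ x, j' x = t := by
    intro t ht
    have : t ∈ LinearMap.ker ρ := ht
    rw [← h2.2.2] at this; exact this
  let d : (C' × V) →ₗ[A] C := LinearMap.coprod φ j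
  have hd : ∀ q : LinearMap.ker d, φ q.1.1 + j q.1.2 = 0 := fun q => q.2
  let eκ := LinearEquiv.ofInjective κ h.1
  have heκ : ∀ z, κ (eκ.symm z) = z := fun z =>
    (LinearEquiv.ofInjective_apply (h := h.1) κ (eκ.symm z)).symm.trans (congrArg Subtype.val (eκ.apply_symm_apply z))
  let ej := LinearEquiv.ofInjective j h1.1
  have hej : ∀ z, j (ej.symm z) = z := fun z =>
    (LinearEquiv.ofInjective_apply (h := h1.1) j (ej.symm z)).symm.trans (congrArg Subtype.val (ej.apply_symm_apply z))
  let b : LinearMap.ker d →ₗ[A] K := eκ.symm.toLinearMap ∘ₗ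
    LinearMap.codRestrict (LinearMap.range κ)
      (ρ ∘ₗ LinearMap.fst A C' V ∘ₗ (LinearMap.ker d).subtype) (by
        intro q
        apply ex
        have := congrArg π (hd q)
        simp only [map_add, hπj, hφ', map_zero, add_zero] at this
        exact this)
  have hb : ∀ q, κ (b q) = ρ q.1.1 := fun q => heκ _
  let s : V' →ₗ[A] V := ej.symm.toLinearMap ∘ₗ
    LinearMap.codRestrict (LinearMap.range j) (φ ∘ₗ j') (by
      intro v
      apply ex1
      simp [hφ', hρj])
  have hs : ∀ v, j (s v) = φ (j' v) := fun v => hej _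
  let a : V' →ₗ[A] LinearMap.ker d := LinearMap.codRestrict _ (LinearMap.prod j' (-s)) (by
    intro v
    simp [d, hs])
  have ha : ∀ v, (a v).1 = (j' v, - s v) := fun v => rfl
  refine ⟨LinearMap.ker d, _, _, a, b, (LinearMap.ker d).subtype, d, ⟨?_, ?_, ?_⟩, ⟨?_, ?_, ?_⟩⟩
  · intro x y hxy
    apply h2.1
    have := congrArg (fun q => q.1.1) hxy
    exact this
  · intro x
    obtain ⟨c, hc⟩ := h2.2.1 (κ x)
    obtain ⟨v, hv⟩ := ex1 (φ c) (by rw [hφ', hc, hθκ])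
    refine ⟨⟨(c, -v), by simp [d, hv]⟩, ?_⟩
    apply h.1
    rw [hb]
    exact hc
  · ext q
    simp only [LinearMap.mem_range, LinearMap.mem_ker]
    constructor
    · rintro ⟨v, rfl⟩
      apply h.1
      rw [hb, ha, map_zero, hρj]
    · intro hq
      have := hb q
      rw [hq, map_zero] at this
      obtain ⟨v, hv⟩ := ex2 _ this.symm
      refine ⟨v, ?_⟩
      apply Subtype.ext
      rw [ha]
      refine Prod.ext hv ?_
      apply h1.1
      have := hd q
      rw [← hv] at this
      simp only [map_neg, hs]
      exact neg_eq_of_add_eq_zero_right this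
  · exact Subtype.val_injective
  · intro c
    obtain ⟨t, ht⟩ := h.2.1 (π c)
    obtain ⟨c', hc'⟩ := h2.2.1 t
    obtain ⟨v, hv⟩ := ex1 (c - φ c') (by rw [map_sub, hφ', hc', ht, sub_self])
    exact ⟨(c', v), by simp [d, hv]⟩
  · simp

theorem mutate_chain {μ : Y →ₗ[A] E} {ε : E →ₗ[A] X} (hs : SES μ ε)
    (hE : InAdd A U E) (hEV : EV A (U × Y) Y 1) {n : ℕ} :
    ∀ {M : Type} [AddCommGroup M] [Module A M], AddCoresChain A (U × X) n M →
    ∃ (N C : Type) (_ : AddCommGroup N) (_ : Module A N) (_ : AddCommGroup C) (_ : Module A C)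
      (r : ℕ) (j : (Fin r → Y) →ₗ[A] C) (π : C →ₗ[A] (M × N)), SES j π ∧ InAdd A (U × X) N ∧
        AddCoresChain A (U × Y) n C := by
  have hUE : InAdd A (U × Y) (U × E) := (InAdd.left U Y).prod ((InAdd.left U Y).trans hE)
  induction n with
  | zero =>
    intro M _ _ h
    obtain ⟨n, N, _, _, hN, ⟨e⟩⟩ := InAdd.compl h
    have hb := base_ses (U := U) hs n
    refine ⟨N, (Fin n → U × E), _, _, _, _, n, _,
      e.symm.toLinearMap ∘ₗ (LinearMap.compLeft (LinearMap.prodMap (LinearMap.id : U →ₗ[A] U) ε) (Fin n)),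
      ⟨hb.1, ?_, ?_⟩, hN, hUE.pi n⟩
    · simpa using hb.2.1
    · rw [hb.2.2, LinearEquiv.ker_comp]
  | succ n ih =>
    intro M _ _ h
    obtain ⟨T₀, Z, _, _, _, _, f, g, hfg, hT, hc⟩ := chain_uncons h
    obtain ⟨N1, C1, _, _, _, _, r1, j1, π1, hs1, hN1, hC1⟩ := ih hc
    obtain ⟨r, N, _, _, hN, ⟨e⟩⟩ := InAdd.compl (hT.prod hN1)
    let κ : (M × N) →ₗ[A] (Fin r → U × X) := e.toLinearMap ∘ₗ
      LinearMap.prodMap (LinearMap.inl A T₀ N1 ∘ₗ f) LinearMap.id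
    let θ : (Fin r → U × X) →ₗ[A] (Z × N1) :=
      (LinearMap.prodMap g LinearMap.id ∘ₗ LinearMap.fst A (T₀ × N1) N) ∘ₗ e.symm.toLinearMap
    have hκθ : SES κ θ := by
      refine ⟨?_, ?_, ?_⟩
      · rintro ⟨x, y⟩ ⟨x', y'⟩ hxy
        have := e.injective hxy
        simp only [LinearMap.prodMap_apply, LinearMap.comp_apply, LinearMap.inl_apply,
          Prod.ext_iff, LinearMap.id_apply] at this
        exact Prod.ext (hfg.1 this.1.1) this.2
      · rintro ⟨z, m⟩
        obtain ⟨t, rfl⟩ := hfg.2.1 z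
        exact ⟨e ((t, m), 0), by simp [θ]⟩
      · ext x
        obtain ⟨⟨⟨t, m⟩, y⟩, rfl⟩ := e.surjective x
        simp only [LinearMap.mem_range, LinearMap.mem_ker]
        constructor
        · rintro ⟨⟨a, b⟩, hab⟩
          have := e.injective hab
          simp only [LinearMap.prodMap_apply, LinearMap.comp_apply, LinearMap.inl_apply,
            Prod.ext_iff, LinearMap.id_apply] at this
          have h0 : g (f a) = 0 := LinearMap.congr_fun hfg.comp a
          simp [θ, ← this.1.1, ← this.1.2, h0]
        · intro hx
          simp only [θ, LinearMap.comp_apply, LinearEquiv.coe_coe, LinearEquiv.symm_apply_apply,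
            LinearMap.fst_apply, LinearMap.prodMap_apply, LinearMap.id_apply, Prod.ext_iff] at hx
          have : t ∈ LinearMap.ker g := hx.1
          rw [← hfg.2.2] at this
          obtain ⟨a, rfl⟩ := this
          refine ⟨(a, y), ?_⟩
          have hm : m = 0 := hx.2
          simp [κ, hm]
    have hb := base_ses (U := U) hs r
    have hYr : EV A (Fin r → U × E) (Fin r1 → Y) 1 :=
      (hEV.left (hUE.pi r)).right (InAdd.refl.pi r1)
    obtain ⟨φ, hφ⟩ := hs1.lift hYr (θ ∘ₗ _)
    obtain ⟨Q, _, _, a, b, c, d, hab, hcd⟩ := step_ses hκθ hs1 hb φ hφ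
    exact ⟨N, Q, _, _, _, _, r, a, b, hab, hN,
      chain_cons hcd ((hUE.pi r).prod ((InAdd.right U Y).pi r1)) hC1⟩

theorem mutate_ev {μ : Y →ₗ[A] E} {ε : E →ₗ[A] X} (hs : SES μ ε)
    (hap : IsRightAddApprox A U ε) (hT : ∀ i, EV A (U × X) (U × X) (i + 1)) :
    ∀ i, EV A (U × Y) (U × Y) (i + 1) := by
  have hUU : ∀ i, EV A U U (i+1) := fun i => ((hT i).left (InAdd.left U X)).right (InAdd.left U X)
  have hUX : ∀ i, EV A U X (i+1) := fun i => ((hT i).left (InAdd.left U X)).right (InAdd.right U X)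
  have hXU : ∀ i, EV A X U (i+1) := fun i => ((hT i).left (InAdd.right U X)).right (InAdd.left U X)
  have hXX : ∀ i, EV A X X (i+1) := fun i => ((hT i).left (InAdd.right U X)).right (InAdd.right U X)
  have hUY : ∀ i, EV A U Y (i+1) := by
    intro i
    cases i with
    | zero => exact hs.sub_right_one ((hUU 0).right hap.1) (fun a => hap.2 U InAdd.refl a)
    | succ i => exact hs.sub_right ((hUU _).right hap.1) (hUX i)
  have hYU : ∀ i, EV A Y U (i+1) := fun i => hs.sub_left ((hUU i).left hap.1) (hXU (i+1))
  have hYX : ∀ i, EV A Y X (i+1) := fun i => hs.sub_left ((hUX i).left hap.1) (hXX (i+1))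
  have hYY : ∀ i, EV A Y Y (i+1) := by
    intro i
    cases i with
    | zero =>
      refine hs.sub_right_one ((hYU 0).right hap.1) (fun a => ?_)
      obtain ⟨f', rfl⟩ := hs.extend (hXX 0) a
      obtain ⟨g, rfl⟩ := hap.2 E hap.1 f'
      exact ⟨g ∘ₗ μ, rfl⟩
    | succ i => exact hs.sub_right ((hYU _).right hap.1) (hYX i)
  have hp : SES (LinearMap.inl A U Y) (LinearMap.snd A U Y) :=
    ⟨LinearMap.inl_injective, LinearMap.snd_surjective, LinearMap.range_inl A U Y⟩
  intro i
  exact hp.mid_left (hp.mid_right (hUU i) (hUY i)) (hp.mid_right (hYU i) (hYY i))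

theorem mutate_semi (k : Type) [Field k] [Algebra k A] {μ : Y →ₗ[A] E} {ε : E →ₗ[A] X} (hs : SES μ ε)
    (hap : IsRightAddApprox A U ε) (h : IsSemiTilting k A (U × X)) :
    IsSemiTilting k A (U × Y) := by
  obtain ⟨h1, n, h2⟩ := h
  have hT : ∀ i, EV A (U × X) (U × X) (i + 1) := fun i =>
    (ext_bridge k A _ _ i).1 (h1 (i+1) (by omega))
  have hT' := mutate_ev hs hap hT
  refine ⟨?_, n, ?_⟩
  · intro i hi
    obtain ⟨i, rfl⟩ : ∃ j, i = j + 1 := ⟨i - 1, by omega⟩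
    exact (ext_bridge k A _ _ i).2 (hT' i)
  · obtain ⟨N, C, _, _, _, _, r, j, π, hjπ, hN, hC⟩ :=
      mutate_chain hs hap.1 ((hT' 0).right (InAdd.right U Y)) h2
    obtain ⟨l, hl⟩ := Module.projective_lifting_property π (LinearMap.inl A A N) hjπ.2.1
    refine chain_retract hT' hC l (LinearMap.fst A A N ∘ₗ π) ?_
    rw [LinearMap.comp_assoc, hl]
    ext; simp

end Mutate

section KS

variable {A : Type} [Ring A] {X Z N M : Type} [AddCommGroup X] [Module A X]
  [AddCommGroup Z] [Module A Z] [AddCommGroup N] [Module A N] [AddCommGroup M] [Module A M]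

theorem fitting [IsArtinian A X] [IsNoetherian A X] (hX : IsIndecomposableModule A X)
    (f : Module.End A X) : IsUnit f ∨ IsNilpotent f := by
  obtain ⟨n, hn⟩ := Filter.eventually_atTop.1 (LinearMap.eventually_isCompl_ker_pow_range_pow f)
  have h := hn (n+1) (by omega)
  rcases hX.2 _ _ h with h1 | h1
  · left
    rw [Module.End.isUnit_iff]
    apply IsArtinian.bijective_of_injective_endomorphism
    rw [LinearMap.ker_eq_bot] at h1
    rw [pow_succ] at h1
    exact Function.Injective.of_comp (f := ⇑(f ^ n)) h1
  · right
    rw [LinearMap.range_eq_bot] at h1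
    exact ⟨n+1, h1⟩

theorem bij_add [IsArtinian A X] [IsNoetherian A X] (hX : IsIndecomposableModule A X)
    {f g : X →ₗ[A] X} (h : Function.Bijective (f + g)) :
    Function.Bijective f ∨ Function.Bijective g := by
  rw [← Module.End.isUnit_iff] at h ⊢
  rw [← Module.End.isUnit_iff]
  obtain ⟨u, hu⟩ := h
  rcases fitting hX ((↑u⁻¹ : Module.End A X) * f) with h1 | h1
  · left
    have := u.isUnit.mul h1
    simpa using this
  · right
    have := u.isUnit.mul h1.isUnit_one_sub
    rw [mul_sub, ← mul_assoc, Units.mul_inv, hu] at this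
    simpa using this

theorem not_bij_zero (hX : IsIndecomposableModule A X) :
    ¬ Function.Bijective (0 : X →ₗ[A] X) := by
  intro h
  obtain ⟨x, hx⟩ := @exists_ne X hX.1 0
  exact hx (h.1 rfl)

theorem bij_sum [IsArtinian A X] [IsNoetherian A X] (hX : IsIndecomposableModule A X)
    {ι : Type} (s : Finset ι) (f : ι → (X →ₗ[A] X)) (h : Function.Bijective (∑ j ∈ s, f j : X →ₗ[A] X)) :
    ∃ j ∈ s, Function.Bijective (f j) := by
  classical
  induction s using Finset.induction_on with
  | empty => exact absurd h (by simpa using not_bij_zero hX)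
  | insert a s ha ih =>
    rw [Finset.sum_insert ha] at h
    rcases bij_add hX h with h | h
    · exact ⟨a, by simp, h⟩
    · obtain ⟨j, hj, h⟩ := ih h
      exact ⟨j, by simp [hj], h⟩

theorem indec_retract (hN : IsIndecomposableModule A N) [Nontrivial Z] (i : Z →ₗ[A] N)
    (p : N →ₗ[A] Z) (h : Function.Bijective (p ∘ₗ i)) :
    Function.Bijective i ∧ Function.Bijective p := by
  have hc : IsCompl (LinearMap.range i) (LinearMap.ker p) := by
    constructor
    · rw [Submodule.disjoint_def]
      rintro _ ⟨x, rfl⟩ hx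
      have : (p ∘ₗ i) x = (p ∘ₗ i) 0 := by simpa using hx
      rw [h.1 this, map_zero]
    · rw [codisjoint_iff, eq_top_iff]
      intro x _
      obtain ⟨z, hz⟩ := h.2 (p x)
      rw [Submodule.mem_sup]
      refine ⟨i z, ⟨z, rfl⟩, x - i z, ?_, by abel⟩
      simp only [LinearMap.mem_ker, map_sub, ← hz]
      simp
  have hp : Function.Bijective p := by
    refine ⟨?_, Function.Surjective.of_comp (g := ⇑i) h.2⟩
    rcases hN.2 _ _ hc with h1 | h1
    · exfalso
      rw [LinearMap.range_eq_bot] at h1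
      obtain ⟨x, hx⟩ := exists_ne (0 : Z)
      apply hx
      apply h.1
      simp [h1]
    · exact LinearMap.ker_eq_bot.1 h1
  refine ⟨?_, hp⟩
  exact (Function.Bijective.of_comp_iff' hp (⇑i)).1 h

theorem basic_sqfree [IsArtinian A Z] [IsNoetherian A Z] (hM : IsBasicModule A M)
    (hZ : IsIndecomposableModule A Z) (a1 a2 : Z →ₗ[A] M) (b1 b2 : M →ₗ[A] Z)
    (h11 : Function.Bijective (b1 ∘ₗ a1)) (h22 : Function.Bijective (b2 ∘ₗ a2))
    (h12 : ¬ Function.Bijective (b1 ∘ₗ a2)) : False := by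
  classical
  obtain ⟨n, N, hint, hind, hiso⟩ := hM
  have := hZ.1
  let e := LinearEquiv.ofBijective (DirectSum.coeLinearMap N) hint
  let π : ∀ i, M →ₗ[A] N i := fun i => DirectSum.component A (Fin n) (fun i => N i) i ∘ₗ e.symm.toLinearMap
  have hπ : ∀ x, ∑ i, ((π i x : N i) : M) = x := by
    intro x
    obtain ⟨y, rfl⟩ := e.surjective x
    have h1 : ∀ i, π i (e y) = y i := by
      intro i
      simp only [π, LinearMap.comp_apply, LinearEquiv.coe_coe, LinearEquiv.symm_apply_apply]
      rfl
    simp only [h1]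
    conv_rhs => rw [← DirectSum.sum_univ_of y, map_sum]
    apply Finset.sum_congr rfl
    intro i _
    exact (DirectSum.coeLinearMap_of N i (y i)).symm
  have key : ∀ (b : M →ₗ[A] Z) (a : Z →ₗ[A] M),
      b ∘ₗ a = ∑ i, (b ∘ₗ (N i).subtype) ∘ₗ (π i ∘ₗ a) := by
    intro b a
    ext x
    conv_lhs => rw [LinearMap.comp_apply, ← hπ (a x), map_sum]
    simp
  rw [key] at h11 h22
  obtain ⟨i, _, hi⟩ := bij_sum hZ _ _ h11
  obtain ⟨j, _, hj⟩ := bij_sum hZ _ _ h22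
  have hi' := indec_retract (hind i) _ _ hi
  have hj' := indec_retract (hind j) _ _ hj
  have hij : i = j := by
    by_contra hne
    exact (hiso i j hne).false ((LinearEquiv.ofBijective _ hi'.1).symm.trans
      (LinearEquiv.ofBijective _ hj'.1))
  subst hij
  have hb : Function.Bijective ((b1 ∘ₗ (N i).subtype) ∘ₗ (π i ∘ₗ a2)) := by
    exact hi'.2.comp hj'.1
  have hsum := key b1 a2
  rw [← Finset.add_sum_erase _ _ (Finset.mem_univ i)] at hsum
  have hsum' : (b1 ∘ₗ (N i).subtype) ∘ₗ (π i ∘ₗ a2) = b1 ∘ₗ a2 +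
      -(∑ l ∈ Finset.univ.erase i, (b1 ∘ₗ (N l).subtype) ∘ₗ (π l ∘ₗ a2)) := by
    rw [hsum]; abel
  rw [hsum'] at hb
  rcases bij_add hZ hb with h | h
  · exact h12 h
  · rw [← Finset.sum_neg_distrib] at h
    obtain ⟨l, hl, hl'⟩ := bij_sum hZ _ _ h
    have hl2 : Function.Bijective ((b1 ∘ₗ (N l).subtype) ∘ₗ (-(π l ∘ₗ a2))) := by
      rw [LinearMap.comp_neg]; exact hl'
    have hl'' := indec_retract (hind l) _ _ hl2
    have hne : i ≠ l := fun h => by simp [h] at hl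
    exact (hiso i l hne).false ((LinearEquiv.ofBijective _ hi'.1).symm.trans
      (LinearEquiv.ofBijective _ hl''.1))

theorem indec_equiv (hN : IsIndecomposableModule A N) (e : N ≃ₗ[A] Z) :
    IsIndecomposableModule A Z := by
  have := hN.1
  refine ⟨e.symm.toEquiv.nontrivial, fun N₁ N₂ h => ?_⟩
  have := hN.2 _ _ ((Submodule.orderIsoMapComap e.symm).isCompl h)
  simpa using this

/-- finite decompositions into indecomposables -/
def Dec (A : Type) [Ring A] (M : Type) [AddCommGroup M] [Module A M] : Prop :=
  ∃ (ι : Type) (_ : Fintype ι) (N : ι → ModuleCat.{0} A),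
    (∀ i, IsIndecomposableModule A (N i)) ∧ Nonempty (M ≃ₗ[A] (∀ i, N i))

theorem Dec.equiv (h : Dec A M) (e : N ≃ₗ[A] M) : Dec A N := by
  obtain ⟨ι, _, N', h1, ⟨e'⟩⟩ := h
  exact ⟨ι, inferInstance, N', h1, ⟨e.trans e'⟩⟩

theorem Dec.prod (h : Dec A M) (h' : Dec A N) : Dec A (M × N) := by
  obtain ⟨ι, _, P, h1, ⟨e⟩⟩ := h
  obtain ⟨ι', _, P', h1', ⟨e'⟩⟩ := h'
  refine ⟨ι ⊕ ι', inferInstance, Sum.elim P P', ?_, ⟨?_⟩⟩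
  · rintro (i | i)
    · exact h1 i
    · exact h1' i
  · exact (LinearEquiv.prodCongr e e').trans
      (LinearEquiv.sumPiEquivProdPi A ι ι' (fun i => ((Sum.elim P P' i : ModuleCat.{0} A) : Type))).symm

theorem dec_sub [IsArtinian A M] (S : Submodule A M) : Dec A S := by
  induction S using WellFoundedLT.induction with
  | ind S ih =>
  by_cases hS : IsIndecomposableModule A S
  · refine ⟨Unit, inferInstance, fun _ => ModuleCat.of A S, fun _ => hS, ⟨?_⟩⟩
    exact (LinearEquiv.funUnique Unit A S).symm
  · by_cases hn : Nontrivial S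
    · have : ∃ N₁ N₂ : Submodule A S, IsCompl N₁ N₂ ∧ N₁ ≠ ⊥ ∧ N₂ ≠ ⊥ := by
        by_contra hcon
        apply hS
        refine ⟨hn, fun N₁ N₂ h => ?_⟩
        by_contra h2
        rw [not_or] at h2
        exact hcon ⟨N₁, N₂, h, h2.1, h2.2⟩
      obtain ⟨N₁, N₂, hc, h1, h2⟩ := this
      have lt : ∀ P : Submodule A S, P ≠ ⊤ → P.map S.subtype < S := by
        intro P hP
        refine lt_of_le_of_ne (Submodule.map_subtype_le S P) ?_
        intro h
        apply hP
        apply Submodule.map_injective_of_injective S.injective_subtype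
        rw [h, Submodule.map_top, Submodule.range_subtype]
      have d1 : Dec A N₁ := (ih _ (lt N₁ (fun h => h2 (by
        have := hc.inf_eq_bot; rwa [h, top_inf_eq] at this)))).equiv (Submodule.equivSubtypeMap S N₁)
      have d2 : Dec A N₂ := (ih _ (lt N₂ (fun h => h1 (by
        have := hc.inf_eq_bot; rwa [h, inf_top_eq] at this)))).equiv (Submodule.equivSubtypeMap S N₂)
      exact (d1.prod d2).equiv (Submodule.prodEquivOfIsCompl N₁ N₂ hc).symm
    · have : Subsingleton S := not_nontrivial_iff_subsingleton.1 hn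
      refine ⟨Empty, inferInstance, fun i => i.elim, fun i => i.elim, ⟨?_⟩⟩
      exact LinearEquiv.ofSubsingleton _ _

theorem dec_all [IsArtinian A M] : Dec A M :=
  (dec_sub (⊤ : Submodule A M)).equiv Submodule.topEquiv.symm

theorem basic_of_dec {ι : Type} [Fintype ι] (N : ι → ModuleCat.{0} A)
    (hN : ∀ i, IsIndecomposableModule A (N i)) (e : M ≃ₗ[A] (∀ i, N i))
    (hiso : ∀ i j, i ≠ j → IsEmpty (N i ≃ₗ[A] N j)) : IsBasicModule A M := by
  classical
  let n := Fintype.card ι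
  let q : Fin n ≃ ι := (Fintype.equivFin ι).symm
  let s : ∀ j, N (q j) →ₗ[A] M := fun j =>
    e.symm.toLinearMap ∘ₗ LinearMap.single A (fun i => N i) (q j)
  have hs : ∀ j, Function.Injective (s j) := fun j =>
    e.symm.injective.comp (LinearMap.ker_eq_bot.1 (LinearMap.ker_single A (fun i => N i) (q j)))
  let E : ∀ j, N (q j) ≃ₗ[A] LinearMap.range (s j) := fun j => LinearEquiv.ofInjective (s j) (hs j)
  refine ⟨n, fun j => LinearMap.range (s j), ⟨?_, ?_⟩, ?_, ?_⟩
  · rw [injective_iff_map_eq_zero]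
    intro x hx
    ext j
    rw [← DirectSum.sum_univ_of x, map_sum] at hx
    have h1 : ∀ l, (DirectSum.coeAddMonoidHom fun j => LinearMap.range (s j))
      (DirectSum.of (fun j => LinearMap.range (s j)) l (x l)) = (x l : M) := fun l =>
        DirectSum.coeAddMonoidHom_of _ _ _
    rw [Finset.sum_congr rfl (fun l _ => h1 l)] at hx
    have h2 := congrFun (congrArg e hx) (q j)
    rw [map_sum, Finset.sum_apply, Finset.sum_eq_single j] at h2
    · obtain ⟨y, hy⟩ := (x j).2
      rw [← hy] at h2
      simp only [s, LinearMap.comp_apply, LinearEquiv.coe_coe, LinearEquiv.apply_symm_apply, map_zero,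
        LinearMap.single_apply, Pi.single_eq_same, Pi.zero_apply] at h2
      rw [← hy, h2]
      simp
    · intro l _ hl
      obtain ⟨y, hy⟩ := (x l).2
      rw [← hy]
      simp only [s, LinearMap.comp_apply, LinearEquiv.coe_coe, LinearEquiv.apply_symm_apply,
        LinearMap.single_apply]
      exact Pi.single_eq_of_ne (fun h => hl (q.injective h.symm)) _
    · simp
  · intro m
    refine ⟨∑ j, DirectSum.of (fun j => LinearMap.range (s j)) j ⟨s j (e m (q j)), ⟨_, rfl⟩⟩, ?_⟩
    rw [map_sum]
    have h1 : ∀ l, (DirectSum.coeAddMonoidHom fun j => LinearMap.range (s j))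
      (DirectSum.of (fun j => LinearMap.range (s j)) l ⟨s l (e m (q l)), ⟨_, rfl⟩⟩) = s l (e m (q l)) :=
        fun l => DirectSum.coeAddMonoidHom_of _ _ _
    rw [Finset.sum_congr rfl (fun l _ => h1 l)]
    apply e.injective
    rw [map_sum]
    have h2 : ∀ l, e (s l (e m (q l))) = Pi.single (q l) (e m (q l)) := by
      intro l
      simp [s]
    rw [Finset.sum_congr rfl (fun l _ => h2 l), q.sum_comp (fun i => Pi.single i (e m i))]
    exact Finset.univ_sum_single (e m)
  · intro j
    exact indec_equiv (hN (q j)) (E j)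
  · intro i j hij
    refine ⟨fun f => ?_⟩
    exact (hiso (q i) (q j) (fun h => hij (q.injective h))).false
      (((E i).trans f).trans (E j).symm)

end KS

section Fin1

variable {A : Type} [Ring A] {U X Y E N : Type} [AddCommGroup U] [Module A U]
  [AddCommGroup X] [Module A X] [AddCommGroup Y] [Module A Y] [AddCommGroup E] [Module A E]
  [AddCommGroup N] [Module A N]

theorem SES.desc {μ : Y →ₗ[A] E} {ε : E →ₗ[A] X} (hs : SES μ ε) (a : E →ₗ[A] N)
    (ha : a ∘ₗ μ = 0) : ∃ b : X →ₗ[A] N, b ∘ₗ ε = a := by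
  have hk : LinearMap.ker ε ≤ LinearMap.ker a := by
    rw [← hs.2.2]
    rintro _ ⟨x, rfl⟩
    exact LinearMap.congr_fun ha x
  refine ⟨(LinearMap.ker ε).liftQ a hk ∘ₗ (ε.quotKerEquivOfSurjective hs.2.1).symm.toLinearMap, ?_⟩
  ext t
  have : (ε.quotKerEquivOfSurjective hs.2.1).symm (ε t) = (LinearMap.ker ε).mkQ t := by
    rw [LinearEquiv.symm_apply_eq]; rfl
  simp [this]

theorem inj_of_bij {μ : Y →ₗ[A] E} {ε : E →ₗ[A] X} (hs : SES μ ε)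
    (hm : IsMinimalRightAddApprox A U ε) (e : Y →ₗ[A] Y) (g : E →ₗ[A] E) (h : X →ₗ[A] X)
    (h1 : g ∘ₗ μ = μ ∘ₗ e) (h2 : h ∘ₗ ε = ε ∘ₗ g) (hb : Function.Bijective h) :
    Function.Injective e := by
  let h' := LinearEquiv.ofBijective h hb
  obtain ⟨g', hg'⟩ := hm.1.2 E hm.1.1 (h'.symm.toLinearMap ∘ₗ ε)
  have : ε ∘ₗ (g' ∘ₗ g) = ε := by
    rw [← LinearMap.comp_assoc, hg', LinearMap.comp_assoc, ← h2]
    ext x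
    exact h'.symm_apply_apply (ε x)
  have hgi : Function.Injective g := Function.Injective.of_comp (f := ⇑g') (hm.2 _ this).1
  have : Function.Injective (μ ∘ₗ e) := by
    rw [← h1]
    exact hgi.comp hs.1
  exact Function.Injective.of_comp (f := ⇑μ) this

theorem not_inAdd_X [IsArtinian A X] [IsNoetherian A X] (hbasic : IsBasicModule A (U × X))
    (hX : IsIndecomposableModule A X) : ¬ InAdd A U X := by
  intro h
  obtain ⟨n, f, g, hfg⟩ := h.sum
  obtain ⟨j, _, hj⟩ := bij_sum hX Finset.univ (fun j => g j ∘ₗ f j) (by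
    rw [hfg]; exact Function.bijective_id)
  refine basic_sqfree hbasic hX (LinearMap.inl A U X ∘ₗ f j) (LinearMap.inr A U X)
    (g j ∘ₗ LinearMap.fst A U X) (LinearMap.snd A U X) hj ?_ ?_
  · exact Function.bijective_id
  · have : (g j ∘ₗ LinearMap.fst A U X) ∘ₗ LinearMap.inr A U X = 0 := by ext; simp
    rw [this]
    exact not_bij_zero hX

theorem not_inAdd_Y {μ : Y →ₗ[A] E} {ε : E →ₗ[A] X} (hs : SES μ ε) (hE : InAdd A U E)
    (hXU : EV A X U 1) (hX : ¬ InAdd A U X) : ¬ InAdd A U Y := by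
  intro h
  obtain ⟨b, hb⟩ := hs.lift (hXU.right h) LinearMap.id
  exact hX (hE.retract b ε hb)

theorem indec_Y [IsArtinian A X] [IsNoetherian A X]
    {μ : Y →ₗ[A] E} {ε : E →ₗ[A] X} (hs : SES μ ε)
    (hm : IsMinimalRightAddApprox A U ε) (hX : IsIndecomposableModule A X)
    (hXU : EV A X U 1) (hY : ¬ InAdd A U Y) : IsIndecomposableModule A Y := by
  constructor
  · by_contra hn
    rw [not_nontrivial_iff_subsingleton] at hn
    exact hY ⟨0, 0, 0, by ext; exact Subsingleton.elim _ _⟩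
  · intro N₁ N₂ hc
    let e : Y →ₗ[A] Y := N₁.subtype ∘ₗ Submodule.projectionOnto N₁ N₂ hc
    have he1 : ∀ x ∈ N₁, e x = x := fun x hx => by
      simp [e, Submodule.projectionOnto_apply_left hc ⟨x, hx⟩]
    have he2 : ∀ x ∈ N₂, e x = 0 := fun x hx => by
      simp [e, (Submodule.projectionOnto_apply_eq_zero_iff hc).2 hx]
    obtain ⟨g, hg⟩ := hs.extend (hXU.right hm.1.1) (μ ∘ₗ e)
    obtain ⟨h, hh⟩ := hs.desc (ε ∘ₗ g) (by
      rw [LinearMap.comp_assoc, hg, ← LinearMap.comp_assoc, hs.comp, LinearMap.zero_comp])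
    have : Function.Bijective (⇑(h + (LinearMap.id - h) : X →ₗ[A] X)) := by
      rw [add_sub_cancel]; exact Function.bijective_id
    rcases bij_add hX this with hb | hb
    · right
      have hi := inj_of_bij hs hm e g h hg hh hb
      rw [Submodule.eq_bot_iff]
      intro x hx
      exact hi (by rw [he2 x hx, map_zero])
    · left
      have hi := inj_of_bij hs hm (LinearMap.id - e) (LinearMap.id - g) (LinearMap.id - h)
        (by rw [LinearMap.sub_comp, LinearMap.comp_sub, hg]; rfl)
        (by rw [LinearMap.sub_comp, LinearMap.comp_sub, hh]; rfl) hb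
      rw [Submodule.eq_bot_iff]
      intro x hx
      exact hi (by simp [he1 x hx])

theorem basic_UY [IsArtinianRing A] [IsNoetherianRing A] [Module.Finite A U] [Module.Finite A X]
    {μ : Y →ₗ[A] E} {ε : E →ₗ[A] X} (hs : SES μ ε)
    (hm : IsMinimalRightAddApprox A U ε) (hbasic : IsBasicModule A (U × X))
    (hX : IsIndecomposableModule A X) (hXU : EV A X U 1) : IsBasicModule A (U × Y) := by
  classical
  have hnX := not_inAdd_X hbasic hX
  have hnY := not_inAdd_Y hs hm.1.1 hXU hnX
  have hY := indec_Y hs hm hX hXU hnY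
  obtain ⟨ι, _, N, hN, ⟨e⟩⟩ := dec_all (A := A) (M := U)
  let p : ∀ i, U →ₗ[A] N i := fun i => LinearMap.proj i ∘ₗ e.toLinearMap
  let s : ∀ i, N i →ₗ[A] U := fun i => e.symm.toLinearMap ∘ₗ LinearMap.single A (fun i => N i) i
  have hps : ∀ i, p i ∘ₗ s i = LinearMap.id := by
    intro i; ext x; simp [p, s]
  have hps' : ∀ i j, i ≠ j → p i ∘ₗ s j = 0 := by
    intro i j hij; ext x; simp [p, s, hij]
  have hiN : ∀ i, InAdd A U (N i) := fun i => InAdd.refl.retract (s i) (p i) (hps i)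
  let P : ι ⊕ Unit → ModuleCat.{0} A := Sum.elim N (fun _ => ModuleCat.of A Y)
  refine basic_of_dec (ι := ι ⊕ Unit) P ?_
    ((LinearEquiv.prodCongr e (LinearEquiv.funUnique Unit A Y).symm).trans
      (LinearEquiv.sumPiEquivProdPi A ι Unit (fun i => (P i : Type))).symm) ?_
  · rintro (i | i)
    · exact hN i
    · exact hY
  · rintro (i | i) (j | j) hij
    · have hij' : i ≠ j := fun h => hij (by rw [h])
      refine ⟨fun (σ : N i ≃ₗ[A] N j) => ?_⟩
      have : Module.Finite A (N i) := Module.Finite.of_surjective (p i) (fun x =>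
        ⟨s i x, LinearMap.congr_fun (hps i) x⟩)
      refine basic_sqfree hbasic (hN i) (LinearMap.inl A U X ∘ₗ s i)
        (LinearMap.inl A U X ∘ₗ s j ∘ₗ σ.toLinearMap) (p i ∘ₗ LinearMap.fst A U X)
        (σ.symm.toLinearMap ∘ₗ p j ∘ₗ LinearMap.fst A U X) ?_ ?_ ?_
      · have : (p i ∘ₗ LinearMap.fst A U X) ∘ₗ LinearMap.inl A U X ∘ₗ s i = LinearMap.id := by
          rw [← hps i]; rfl
        rw [this]; exact Function.bijective_id
      · have : (σ.symm.toLinearMap ∘ₗ p j ∘ₗ LinearMap.fst A U X) ∘ₗ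
            LinearMap.inl A U X ∘ₗ s j ∘ₗ σ.toLinearMap = LinearMap.id := by
          ext x
          have := LinearMap.congr_fun (hps j) (σ x)
          simp only [LinearMap.comp_apply, LinearMap.id_apply] at this
          simp [this]
        rw [this]; exact Function.bijective_id
      · have : (p i ∘ₗ LinearMap.fst A U X) ∘ₗ LinearMap.inl A U X ∘ₗ s j ∘ₗ σ.toLinearMap = 0 := by
          ext x
          have := LinearMap.congr_fun (hps' i j hij') (σ x)
          simp only [LinearMap.comp_apply, LinearMap.zero_apply] at this
          simp [this]
        rw [this]; exact not_bij_zero (hN i)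
    · exact ⟨fun (σ : N i ≃ₗ[A] Y) => hnY ((hiN i).equiv σ)⟩
    · exact ⟨fun (σ : Y ≃ₗ[A] N j) => hnY ((hiN j).equiv σ.symm)⟩
    · exact absurd rfl hij

theorem hom_gen (k : Type) [Field k] [Algebra k A] [FiniteDimensional k A]
    [Module.Finite A U] [Module.Finite A X] :
    ∃ (n : ℕ) (f : (Fin n → U) →ₗ[A] X), ∀ a : U →ₗ[A] X, ∃ b : U →ₗ[A] (Fin n → U), f ∘ₗ b = a := by
  letI : Module k U := Module.compHom U (algebraMap k A)
  letI : Module k X := Module.compHom X (algebraMap k A)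
  haveI : IsScalarTower k A U := IsScalarTower.of_algebraMap_smul (fun _ _ => rfl)
  haveI : IsScalarTower k A X := IsScalarTower.of_algebraMap_smul (fun _ _ => rfl)
  haveI : Module.Finite k U := Module.Finite.trans A U
  haveI : Module.Finite k X := Module.Finite.trans A X
  haveI : SMulCommClass A k X := inferInstance
  haveI : SMulCommClass A k U := inferInstance
  haveI : Module.Finite k (U →ₗ[A] X) :=
    Module.Finite.of_injective (LinearMap.restrictScalarsₗ k A U X k)
      (LinearMap.restrictScalars_injective k)
  obtain ⟨n, s, hs⟩ := Module.Finite.exists_fin (R := k) (M := U →ₗ[A] X)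
  refine ⟨n, ∑ j, s j ∘ₗ LinearMap.proj j, fun a => ?_⟩
  have ha : a ∈ Submodule.span k (Set.range s) := by rw [hs]; trivial
  obtain ⟨c, hc⟩ := (Submodule.mem_span_range_iff_exists_fun k).1 ha
  refine ⟨LinearMap.pi (fun j => c j • LinearMap.id), ?_⟩
  rw [← hc]
  ext x
  simp only [LinearMap.comp_apply, LinearMap.coe_sum, Finset.sum_apply, LinearMap.proj_apply,
    LinearMap.pi_apply, LinearMap.smul_apply, LinearMap.id_apply]
  apply Finset.sum_congr rfl
  intro j _
  exact (s j).map_smul_of_tower (c j) x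

theorem approx_of_U {f : E →ₗ[A] X} (hE : InAdd A U E)
    (h : ∀ a : U →ₗ[A] X, ∃ b : U →ₗ[A] E, f ∘ₗ b = a) : IsRightAddApprox A U f := by
  refine ⟨hE, fun C _ _ hC a => ?_⟩
  obtain ⟨n, p, q, hpq⟩ := hC.sum
  choose b hb using fun j => h (a ∘ₗ q j)
  refine ⟨∑ j, b j ∘ₗ p j, ?_⟩
  ext x
  have hx : ∑ j, q j (p j x) = x := by
    have := LinearMap.congr_fun hpq x
    simpa using this
  conv_rhs => rw [← hx]
  simp only [LinearMap.comp_apply, LinearMap.coe_sum, Finset.sum_apply, map_sum]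
  exact Finset.sum_congr rfl (fun j _ => LinearMap.congr_fun (hb j) (p j x))

theorem min_approx (k : Type) [Field k] [Algebra k A] [FiniteDimensional k A]
    [IsArtinianRing A] [IsNoetherianRing A]
    [Module.Finite A U] [Module.Finite A X] :
    ∃ (n : ℕ) (S : Submodule A (Fin n → U)) (ε : S →ₗ[A] X), IsMinimalRightAddApprox A U ε := by
  obtain ⟨n, f, hf⟩ := hom_gen (A := A) (U := U) (X := X) k
  let 𝒮 : Set (Submodule A (Fin n → U)) := {S | IsRightAddApprox A U (f ∘ₗ S.subtype)}
  have hne : 𝒮.Nonempty := by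
    refine ⟨⊤, approx_of_U ((InAdd.refl.pi n).equiv Submodule.topEquiv.symm) (fun a => ?_)⟩
    obtain ⟨b, hb⟩ := hf a
    exact ⟨Submodule.topEquiv.symm.toLinearMap ∘ₗ b, by rw [← hb]; rfl⟩
  obtain ⟨S, hS, hmin⟩ := IsArtinian.set_has_minimal 𝒮 hne
  refine ⟨n, S, f ∘ₗ S.subtype, hS, fun g hg => ?_⟩
  obtain ⟨m, hm⟩ := Filter.eventually_atTop.1
    (LinearMap.eventually_isCompl_ker_pow_range_pow (g : Module.End A S))
  have hc := hm (m+1) (by omega)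
  set G : Module.End A S := (g : Module.End A S) ^ (m+1) with hG
  have hpow : ∀ l : ℕ, (f ∘ₗ S.subtype) ∘ₗ ((g : Module.End A S) ^ l) = f ∘ₗ S.subtype := by
    intro l
    induction l with
    | zero => rfl
    | succ l ih =>
      rw [pow_succ, Module.End.mul_eq_comp, ← LinearMap.comp_assoc, ih, hg]
  let R := LinearMap.range G
  let S' := R.map S.subtype
  let e : R ≃ₗ[A] S' := Submodule.equivSubtypeMap S R
  have hS' : S' ∈ 𝒮 := by
    refine approx_of_U ?_ (fun a => ?_)
    · refine InAdd.equiv (M := ↥R) (N := ↥S') ?_ e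
      refine hS.1.retract R.subtype (Submodule.projectionOnto R _ hc.symm) ?_
      ext x
      simp
    · obtain ⟨b, hb⟩ := hS.2 U InAdd.refl a
      refine ⟨e.toLinearMap ∘ₗ G.rangeRestrict ∘ₗ b, ?_⟩
      rw [← hb]
      ext x
      exact LinearMap.congr_fun (hpow (m+1)) (b x)
  have hle : S' ≤ S := Submodule.map_subtype_le S R
  have heq : S' = S := by
    by_contra hne
    exact hmin S' hS' (lt_of_le_of_ne hle hne)
  have htop : R = ⊤ := by
    apply Submodule.map_injective_of_injective S.injective_subtype
    change S' = _
    rw [heq, Submodule.map_top, Submodule.range_subtype]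
  have hsurj : Function.Surjective G := LinearMap.range_eq_top.1 htop
  have : Function.Surjective g := by
    rw [hG, pow_succ'] at hsurj
    exact Function.Surjective.of_comp (g := ⇑((g : Module.End A S) ^ m)) hsurj
  exact IsNoetherian.bijective_of_surjective_endomorphism g this

end Fin1

/-- if `T = U ⊕ X` is basic semi-tilting with `X` indecomposable and
`X ∈ gen U`, then a short exact sequence `0 → Y → E → X → 0` with `ε` a minimal right
`add U`-approximation exists, and for any such sequence `U ⊕ Y` is again a basic
semi-tilting module. -/
theorem mutation_exists_and_isBasicSemiTilting
    (k : Type) [Field k] [IsAlgClosed k]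
    (A : Type) [Ring A] [Algebra k A] [FiniteDimensional k A]
    (U X : Type)
    [AddCommGroup U] [Module A U] [Module.Finite A U]
    [AddCommGroup X] [Module A X] [Module.Finite A X]
    (hbasic : IsBasicModule A (U × X))
    (hst : IsSemiTilting k A (U × X))
    (hX : IsIndecomposableModule A X)
    (hgen : InGen A U X) :
    (∃ (Y E : Type) (_ : AddCommGroup Y) (_ : Module A Y) (_ : Module.Finite A Y)
        (_ : AddCommGroup E) (_ : Module A E) (_ : Module.Finite A E)
        (μ : Y →ₗ[A] E) (ε : E →ₗ[A] X),
        Function.Injective μ ∧ Function.Surjective ε ∧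
          LinearMap.range μ = LinearMap.ker ε ∧ IsMinimalRightAddApprox A U ε) ∧
    ∀ (Y : Type) [AddCommGroup Y] [Module A Y] [Module.Finite A Y]
      (E : Type) [AddCommGroup E] [Module A E] [Module.Finite A E]
      (μ : Y →ₗ[A] E) (ε : E →ₗ[A] X),
      Function.Injective μ → Function.Surjective ε →
        LinearMap.range μ = LinearMap.ker ε → IsMinimalRightAddApprox A U ε →
          IsBasicModule A (U × Y) ∧ IsSemiTilting k A (U × Y) := by
  haveI : IsArtinianRing A := IsArtinianRing.of_finite k A
  haveI : IsNoetherianRing A := inferInstance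
  refine ⟨?_, ?_⟩
  · obtain ⟨n, S, ε, hε⟩ := min_approx (A := A) (U := U) (X := X) k
    refine ⟨LinearMap.ker ε, S, inferInstance, inferInstance, inferInstance, inferInstance,
      inferInstance, inferInstance, (LinearMap.ker ε).subtype, ε, Subtype.val_injective, ?_,
      by simp, hε⟩
    obtain ⟨m, _, p, hp⟩ := hgen
    obtain ⟨g, hg⟩ := hε.1.2 _ (InAdd.refl.pi m) p
    rw [← hg] at hp
    exact Function.Surjective.of_comp (g := ⇑g) hp
  · intro Y _ _ _ E _ _ _ μ ε hμ hε hr hm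
    have hs : SES μ ε := ⟨hμ, hε, hr⟩
    have hT : EV A (U × X) (U × X) 1 := (ext_bridge k A _ _ 0).1 (hst.1 1 le_rfl)
    have hXU : EV A X U 1 := (hT.left (InAdd.right U X)).right (InAdd.left U X)
    exact ⟨basic_UY hs hm hbasic hX hXU, mutate_semi k hs hm.1 hst⟩
end
end

section
/- Let k be an algebraically closed field, A a finite-dimensional k-algebra, and T = U ⊕ X a basic semi-tilting left A-module with X indecomposable and X ∈ gen U. Let 0 → Y →μ→ E →ε→ X → 0 be a short exact sequence with ε : E → X a minimal right add U-approximation, and set B = End_A(T). Then applying Hom_A(−,T) yields an exact sequence of left B-modules 0 → Hom_A(X,T) →ε*→ Hom_A(E,T) →μ*→ Hom_A(Y,T) → 0 in which Hom_A(X,T) and Hom_A(E,T) are projective left B-modules and the image of ε* is a superfluous submodule of Hom_A(E,T) (i.e., for every B-submodule N of Hom_A(E,T) with N + Im ε* = Hom_A(E,T) one has N = Hom_A(E,T)); in other words, this sequence is a minimal projective resolution of the left B-module L = Hom_A(Y,T). -/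
open CategoryTheory

noncomputable section

lemma aux_single {A U : Type} [Ring A] [AddCommGroup U] [Module A U] {n : ℕ} (v : Fin n → U) :
    ∑ j, LinearMap.single A (fun _ : Fin n => U) j (v j) = v :=
  Finset.univ_sum_single v

lemma aux_local {A X : Type} [Ring A] [AddCommGroup X] [Module A X]
    [IsArtinian A X] [IsNoetherian A X] (hX : IsIndecomposableModule A X)
    (f : Module.End A X) : IsUnit f ∨ IsUnit (1 - f) := by
  obtain ⟨n, hn⟩ := Filter.eventually_atTop.mp f.eventually_isCompl_ker_pow_range_pow
  have h := hn (n + 1) (by omega)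
  rcases hX.2 _ _ h with h1 | h1
  · left
    have hinj : Function.Injective (f ^ (n + 1)) := LinearMap.ker_eq_bot.mp h1
    have hi : Function.Injective f := by
      rw [pow_succ] at hinj
      exact Function.Injective.of_comp (f := ⇑(f ^ n)) hinj
    rw [Module.End.isUnit_iff]
    exact ⟨hi, IsArtinian.surjective_of_injective_endomorphism f hi⟩
  · right
    have : IsNilpotent f := ⟨n + 1, LinearMap.range_eq_bot.mp h1⟩
    exact this.isUnit_one_sub

lemma aux_sum {R ι : Type} [Ring R] [Nontrivial R] (hR : ∀ f : R, IsUnit f ∨ IsUnit (1 - f))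
    (s : Finset ι) (a : ι → R) (h : IsUnit (∑ i ∈ s, a i)) : ∃ i ∈ s, IsUnit (a i) := by
  classical
  induction s using Finset.induction_on with
  | empty => simp at h
  | insert i s hi ih =>
    rw [Finset.sum_insert hi] at h
    obtain ⟨w, hw⟩ := h
    rcases hR ((↑w⁻¹ : R) * a i) with h1 | h1
    · exact ⟨i, Finset.mem_insert_self _ _, (Units.isUnit_units_mul w⁻¹ (a i)).mp h1⟩
    · have h2 : (1 : R) - (↑w⁻¹ : R) * a i = (↑w⁻¹ : R) * ∑ j ∈ s, a j := by
        rw [← Units.inv_mul w, hw, mul_add]; abel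
      rw [h2] at h1
      obtain ⟨j, hj, hu⟩ := ih ((Units.isUnit_units_mul w⁻¹ _).mp h1)
      exact ⟨j, Finset.mem_insert_of_mem hj, hu⟩

lemma aux_bij {A X N : Type} [Ring A] [AddCommGroup X] [Module A X] [AddCommGroup N] [Module A N]
    (hX : Nontrivial X) (hN : IsIndecomposableModule A N)
    (v : X →ₗ[A] N) (u : N →ₗ[A] X) (h : Function.Bijective (u ∘ₗ v)) :
    Function.Bijective v ∧ Function.Bijective u := by
  have hc : IsCompl (LinearMap.range v) (LinearMap.ker u) := by
    constructor
    · rw [Submodule.disjoint_def]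
      rintro _ ⟨x, rfl⟩ hx
      have : x = 0 := h.1 (by simpa using hx)
      simp [this]
    · rw [codisjoint_iff, eq_top_iff]
      intro n _
      obtain ⟨x, hx⟩ := h.2 (u n)
      rw [Submodule.mem_sup]
      refine ⟨v x, ⟨x, rfl⟩, n - v x, ?_, by abel⟩
      simp only [LinearMap.comp_apply] at hx
      simp [hx]
  have hus : Function.Surjective u := Function.Surjective.of_comp (g := v) h.2
  rcases hN.2 _ _ hc with h1 | h1
  · exfalso
    have hv : v = 0 := LinearMap.range_eq_bot.mp h1
    obtain ⟨x, hx⟩ := exists_ne (0 : X)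
    exact hx (h.1 (by simp [hv]))
  · have hu : Function.Bijective u := ⟨LinearMap.ker_eq_bot.mp h1, hus⟩
    refine ⟨?_, hu⟩
    have := h
    rw [LinearMap.coe_comp] at this
    exact (Function.Bijective.of_comp_iff' hu v).mp this

lemma aux_basic {A X T : Type} [Ring A] [AddCommGroup X] [Module A X]
    [AddCommGroup T] [Module A T]
    [IsArtinian A X] [IsNoetherian A X] (hX : IsIndecomposableModule A X)
    (hT : IsBasicModule A T)
    (s₁ s₂ : X →ₗ[A] T) (r₁ r₂ : T →ₗ[A] X)
    (h11 : IsUnit (r₁ ∘ₗ s₁ : Module.End A X)) (h22 : IsUnit (r₂ ∘ₗ s₂ : Module.End A X))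
    (h12 : r₁ ∘ₗ s₂ = 0) : False := by
  classical
  obtain ⟨n, N, hN, hind, hni⟩ := hT
  have hnt := hX.1
  have : Nontrivial (Module.End A X) := inferInstance
  let e := LinearEquiv.ofBijective (DirectSum.coeLinearMap N) hN
  let pr : ∀ i, T →ₗ[A] N i := fun i => DirectSum.component A (Fin n) (fun i => N i) i ∘ₗ e.symm.toLinearMap
  have hpr : ∀ t : T, ∑ i, ((pr i t : N i) : T) = t := by
    intro t
    obtain ⟨z, rfl⟩ := e.surjective t
    simp only [pr, LinearMap.comp_apply, LinearEquiv.coe_coe, LinearEquiv.symm_apply_apply]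
    show _ = DirectSum.coeLinearMap N z
    conv_rhs => rw [← DirectSum.sum_univ_of z]
    rw [map_sum]
    refine Finset.sum_congr rfl fun i _ => ?_
    exact (DirectSum.coeLinearMap_of N i (z i)).symm
  have hsum : ∀ (r : T →ₗ[A] X) (s : X →ₗ[A] T),
      (r ∘ₗ s : Module.End A X) = ∑ i, ((r ∘ₗ (N i).subtype) ∘ₗ (pr i ∘ₗ s) : Module.End A X) := by
    intro r s
    ext x
    rw [LinearMap.sum_apply]
    simp only [LinearMap.comp_apply, Submodule.subtype_apply]
    rw [← map_sum, hpr]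
  have key : ∀ (r : T →ₗ[A] X) (s : X →ₗ[A] T) (i : Fin n),
      IsUnit ((r ∘ₗ (N i).subtype) ∘ₗ (pr i ∘ₗ s) : Module.End A X) →
      Function.Bijective (pr i ∘ₗ s) ∧ Function.Bijective (r ∘ₗ (N i).subtype) := by
    intro r s i hu
    exact aux_bij hnt (hind i) _ _ ((Module.End.isUnit_iff _).mp hu)
  have hl := aux_local hX
  rw [hsum] at h11 h22
  obtain ⟨i, -, hi⟩ := aux_sum hl _ _ h11
  obtain ⟨j, -, hj⟩ := aux_sum hl _ _ h22
  have hi' := key _ _ _ hi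
  have hj' := key _ _ _ hj
  have eqij : ∀ (a b : Fin n) (f : X →ₗ[A] N a) (g : X →ₗ[A] N b), Function.Bijective f →
      Function.Bijective g → a = b := by
    intro a b f g hf hg
    by_contra hab
    exact (hni a b hab).false ((LinearEquiv.ofBijective f hf).symm.trans (LinearEquiv.ofBijective g hg))
  obtain rfl := eqij i j _ _ hi'.1 hj'.1
  have hu : IsUnit ((r₁ ∘ₗ (N i).subtype) ∘ₗ (pr i ∘ₗ s₂) : Module.End A X) := by
    rw [Module.End.isUnit_iff]
    exact hi'.2.comp hj'.1
  have h0 := hsum r₁ s₂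
  rw [h12, ← Finset.add_sum_erase _ _ (Finset.mem_univ i)] at h0
  have h1 := neg_eq_of_add_eq_zero_right h0.symm
  obtain ⟨l, hl1, hl2⟩ := aux_sum hl _ _ (h1 ▸ hu.neg)
  have hli := eqij l i _ _ (key _ _ _ hl2).1 hi'.1
  exact (Finset.ne_of_mem_erase hl1) hli

lemma aux_not_add {A U X : Type} [Ring A] [AddCommGroup X] [Module A X]
    [AddCommGroup U] [Module A U]
    [IsArtinian A X] [IsNoetherian A X] (hX : IsIndecomposableModule A X)
    (hT : IsBasicModule A (U × X)) (n : ℕ) (i : X →ₗ[A] (Fin n → U)) (p : (Fin n → U) →ₗ[A] X)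
    (h : IsUnit (p ∘ₗ i : Module.End A X)) : False := by
  classical
  have hnt := hX.1
  have : Nontrivial (Module.End A X) := inferInstance
  have hs : (p ∘ₗ i : Module.End A X) =
      ∑ j, ((p ∘ₗ LinearMap.single A (fun _ => U) j) ∘ₗ (LinearMap.proj j ∘ₗ i) : Module.End A X) := by
    ext x
    rw [LinearMap.sum_apply]
    simp only [LinearMap.comp_apply, LinearMap.proj_apply]
    rw [← map_sum, aux_single]
  rw [hs] at h
  obtain ⟨j, -, hj⟩ := aux_sum (aux_local hX) _ _ h
  refine aux_basic hX hT (LinearMap.inl A U X ∘ₗ (LinearMap.proj j ∘ₗ i)) (LinearMap.inr A U X)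
    ((p ∘ₗ LinearMap.single A (fun _ => U) j) ∘ₗ LinearMap.fst A U X) (LinearMap.snd A U X) ?_ ?_ ?_
  · exact hj
  · exact isUnit_one (M := Module.End A X)
  · ext x; simp

lemma aux_ext {k A T Y E : Type} [Field k] [Ring A] [Algebra k A] [AddCommGroup T] [Module A T]
    [AddCommGroup Y] [Module A Y] [AddCommGroup E] [Module A E]
    (hT : ExtSelfVanish k A T) (μ : Y →ₗ[A] E) (q : E →ₗ[A] T)
    (hμ : Function.Injective μ) (hq : Function.Surjective q)
    (hex : LinearMap.range μ = LinearMap.ker q) (h : Y →ₗ[A] T) :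
    ∃ H : E →ₗ[A] T, H ∘ₗ μ = h := by
  let P := projectiveResolution (ModuleCat.of A T)
  have hsub := hT 1 le_rfl
  have hz : Limits.IsZero ((P.complex.linearYonedaObj k (ModuleCat.of A T)).homology 1) :=
    (ModuleCat.isZero_of_subsingleton _).of_iso (P.isoExt 1 (ModuleCat.of A T)).symm
  rw [← HomologicalComplex.exactAt_iff_isZero_homology,
    HomologicalComplex.exactAt_iff' _ 0 1 2 (by simp) (by simp),
    ShortComplex.moduleCat_exact_iff] at hz
  have hz' : ∀ f : P.complex.X 1 ⟶ ModuleCat.of A T, P.complex.d 2 1 ≫ f = 0 →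
      ∃ c : P.complex.X 0 ⟶ ModuleCat.of A T, P.complex.d 1 0 ≫ c = f := fun f hf => hz f hf
  let π : P.complex.X 0 ⟶ ModuleCat.of A T := P.π.f 0
  have hepi : Epi π := inferInstanceAs (Epi (P.π.f 0))
  have hπs : Function.Surjective π := (ModuleCat.epi_iff_surjective π).mp hepi
  have hdπ : P.complex.d 1 0 ≫ π = 0 := P.complex_d_comp_π_f_zero
  have hex0 : (ShortComplex.mk _ _ hdπ).Exact := P.exact₀
  rw [ShortComplex.moduleCat_exact_iff] at hex0
  have hqe : Epi (ModuleCat.ofHom q) := (ModuleCat.epi_iff_surjective _).mpr hq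
  have hμe : Mono (ModuleCat.ofHom μ) := (ModuleCat.mono_iff_injective _).mpr hμ
  let a : P.complex.X 0 ⟶ ModuleCat.of A E := Projective.factorThru π (ModuleCat.ofHom q)
  have ha : a ≫ ModuleCat.ofHom q = π := Projective.factorThru_comp _ _
  have hμq : ModuleCat.ofHom μ ≫ ModuleCat.ofHom q = 0 := by
    ext y
    have : μ y ∈ LinearMap.ker q := hex ▸ ⟨y, rfl⟩
    exact this
  have hS : (ShortComplex.mk _ _ hμq).Exact := by
    rw [ShortComplex.moduleCat_exact_iff]
    intro x hx
    have : x ∈ LinearMap.range μ := by rw [hex]; exact hx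
    exact this
  have h10 : (P.complex.d 1 0 ≫ a) ≫ ModuleCat.ofHom q = 0 := by
    rw [Category.assoc, ha, hdπ]
  let b : P.complex.X 1 ⟶ ModuleCat.of A Y := hS.liftFromProjective (P.complex.d 1 0 ≫ a) h10
  have hb : b ≫ ModuleCat.ofHom μ = P.complex.d 1 0 ≫ a :=
    hS.liftFromProjective_comp (P.complex.d 1 0 ≫ a) h10
  have hb0 : P.complex.d 2 1 ≫ b = 0 := by
    rw [← cancel_mono (ModuleCat.ofHom μ), Category.assoc, hb]
    simp
  obtain ⟨c, hc⟩ := hz' (b ≫ ModuleCat.ofHom h) (by rw [← Category.assoc, hb0]; simp)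
  have ha' : ∀ x, q (a.hom x) = π.hom x := fun x => by rw [← ha]; rfl
  have hb' : ∀ x, μ (b.hom x) = a.hom ((P.complex.d 1 0).hom x) := fun x => congr($hb x)
  have hc' : ∀ x, c.hom ((P.complex.d 1 0).hom x) = h (b.hom x) := fun x => congr($hc x)
  let F : (P.complex.X 0 × Y) →ₗ[A] E := LinearMap.coprod a.hom μ
  let G : (P.complex.X 0 × Y) →ₗ[A] T := LinearMap.coprod c.hom h
  have hF : Function.Surjective F := by
    intro e
    obtain ⟨x, hx⟩ := hπs (q e)
    have : e - a.hom x ∈ LinearMap.range μ := by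
      rw [hex, LinearMap.mem_ker, map_sub, ha', sub_eq_zero]
      exact hx.symm
    obtain ⟨y, hy⟩ := this
    refine ⟨(x, y), ?_⟩
    simp [F, hy]
  have hFG : LinearMap.ker F ≤ LinearMap.ker G := by
    rintro ⟨x, y⟩ hxy
    have h1 : a.hom x + μ y = 0 := hxy
    have hqμ : q (μ y) = 0 := by
      have : μ y ∈ LinearMap.ker q := hex ▸ ⟨y, rfl⟩
      exact this
    have h2 : π.hom x = 0 := by
      have := congrArg q h1
      rwa [map_add, hqμ, add_zero, map_zero, ha'] at this
    obtain ⟨z, hz1⟩ := hex0 x h2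
    have hz2 : (P.complex.d 1 0).hom z = x := hz1
    have h3 : b.hom z + y = 0 := by
      apply hμ
      rw [map_add, map_zero, hb', hz2, h1]
    show c.hom x + h y = 0
    rw [← hz2, hc', ← map_add, h3, map_zero]
  refine ⟨(LinearMap.ker F).liftQ G hFG ∘ₗ (F.quotKerEquivOfSurjective hF).symm.toLinearMap, ?_⟩
  ext1 y
  show (LinearMap.ker F).liftQ G hFG ((F.quotKerEquivOfSurjective hF).symm (μ y)) = h y
  have : (F.quotKerEquivOfSurjective hF).symm (μ y) = Submodule.Quotient.mk (0, y) := by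
    rw [LinearEquiv.symm_apply_eq]
    show μ y = F (0, y)
    simp [F]
  rw [this]
  show G (0, y) = h y
  simp [G]

/-- applying `Hom_A(-, T)` to `0 → Y → E → X → 0` gives a minimal projective
resolution `0 → Hom_A(X,T) → Hom_A(E,T) → Hom_A(Y,T) → 0` of the left `B`-module
`L = Hom_A(Y,T)`, where `B = End_A(T)` and `T = U ⊕ X`. -/
theorem hom_sequence_minimal_projective_resolution
    (k : Type) [Field k] [IsAlgClosed k]
    (A : Type) [Ring A] [Algebra k A] [FiniteDimensional k A]
    (U X Y E : Type)
    [AddCommGroup U] [Module A U] [Module.Finite A U]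
    [AddCommGroup X] [Module A X] [Module.Finite A X]
    [AddCommGroup Y] [Module A Y] [Module.Finite A Y]
    [AddCommGroup E] [Module A E] [Module.Finite A E]
    (hbasic : IsBasicModule A (U × X))
    (hst : IsSemiTilting k A (U × X))
    (hX : IsIndecomposableModule A X)
    (hgen : InGen A U X)
    (μ : Y →ₗ[A] E) (ε : E →ₗ[A] X)
    (hμ : Function.Injective μ) (hε : Function.Surjective ε)
    (hexact : LinearMap.range μ = LinearMap.ker ε)
    (hmin : IsMinimalRightAddApprox A U ε) :
    Function.Injective (homPrecomp A (T := U × X) ε) ∧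
    LinearMap.range (homPrecomp A (T := U × X) ε) =
      LinearMap.ker (homPrecomp A (T := U × X) μ) ∧
    Function.Surjective (homPrecomp A (T := U × X) μ) ∧
    Module.Projective (Module.End A (U × X)) (X →ₗ[A] (U × X)) ∧
    Module.Projective (Module.End A (U × X)) (E →ₗ[A] (U × X)) ∧
    ∀ N : Submodule (Module.End A (U × X)) (E →ₗ[A] (U × X)),
      N ⊔ LinearMap.range (homPrecomp A (T := U × X) ε) = ⊤ → N = ⊤ := by
  have : IsArtinianRing A := IsArtinianRing.of_finite k A
  have hApp := hmin.1
  obtain ⟨⟨n, i, p, hpi⟩, -⟩ := hApp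
  refine ⟨?_, ?_, ?_, ?_, ?_, ?_⟩
  · intro f g hfg
    exact (LinearMap.cancel_right hε).mp hfg
  · ext f
    constructor
    · rintro ⟨g, rfl⟩
      rw [LinearMap.mem_ker]
      ext1 y
      have : ε (μ y) = 0 := by
        rw [← LinearMap.mem_ker, ← hexact]; exact ⟨y, rfl⟩
      show g (ε (μ y)) = 0
      rw [this, map_zero]
    · intro hf
      rw [LinearMap.mem_ker] at hf
      have hk : LinearMap.ker ε ≤ LinearMap.ker f := by
        rw [← hexact]
        rintro _ ⟨y, rfl⟩
        exact LinearMap.congr_fun hf y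
      refine ⟨(LinearMap.ker ε).liftQ f hk ∘ₗ (ε.quotKerEquivOfSurjective hε).symm.toLinearMap, ?_⟩
      ext1 e
      show (LinearMap.ker ε).liftQ f hk ((ε.quotKerEquivOfSurjective hε).symm (ε e)) = f e
      have : (ε.quotKerEquivOfSurjective hε).symm (ε e) = Submodule.Quotient.mk e := by
        rw [LinearEquiv.symm_apply_eq]; rfl
      rw [this]; rfl
  · intro h
    obtain ⟨H, hH⟩ := aux_ext hst.1 (LinearMap.inr A U E ∘ₗ μ)
      (LinearMap.prodMap LinearMap.id ε)
      (LinearMap.inr_injective.comp hμ)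
      (by
        rintro ⟨u, x⟩
        obtain ⟨e, rfl⟩ := hε x
        exact ⟨(u, e), rfl⟩)
      (by
        ext ⟨u, e⟩
        have : e ∈ LinearMap.range μ ↔ e ∈ LinearMap.ker ε := by rw [hexact]
        simp only [LinearMap.mem_range, LinearMap.mem_ker] at this
        simp only [LinearMap.mem_range, LinearMap.comp_apply, LinearMap.inr_apply, Prod.mk.injEq,
          LinearMap.mem_ker, LinearMap.prodMap_apply, LinearMap.id_apply, Prod.mk_eq_zero, ← this]
        constructor
        · rintro ⟨y, rfl, rfl⟩
          exact ⟨rfl, y, rfl⟩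
        · rintro ⟨rfl, y, rfl⟩
          exact ⟨y, rfl, rfl⟩) h
    refine ⟨H ∘ₗ LinearMap.inr A U E, ?_⟩
    rw [← hH]; rfl
  · refine Module.Projective.of_split
      (homPrecomp A (T := U × X) (LinearMap.snd A U X) : _ →ₗ[_] (Module.End A (U × X)))
      (homPrecomp A (T := U × X) (LinearMap.inr A U X)) ?_
    ext f x <;> rfl
  · let α : (E →ₗ[A] (U × X)) →ₗ[Module.End A (U × X)] (Fin n → Module.End A (U × X)) :=
      LinearMap.pi fun j => homPrecomp A (T := U × X)
        (p ∘ₗ LinearMap.single A (fun _ => U) j ∘ₗ LinearMap.fst A U X)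
    let β : (Fin n → Module.End A (U × X)) →ₗ[Module.End A (U × X)] (E →ₗ[A] (U × X)) :=
      ∑ j, (homPrecomp A (T := U × X) (LinearMap.inl A U X ∘ₗ LinearMap.proj j ∘ₗ i)) ∘ₗ
        (LinearMap.proj j : (Fin n → Module.End A (U × X)) →ₗ[Module.End A (U × X)] _)
    refine Module.Projective.of_split α β ?_
    refine LinearMap.ext fun f => ?_
    refine LinearMap.ext fun e => ?_
    have h1 : p (i e) = e := LinearMap.congr_fun hpi e
    have h2 : β (α f) e = ∑ j, f (p (Pi.single j (i e j))) := by
      simp only [β, LinearMap.sum_apply]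
      rfl
    show β (α f) e = f e
    rw [h2, ← map_sum, ← map_sum]
    conv_rhs => rw [← h1, ← aux_single (A := A) (i e)]
    rfl
  · intro N hN
    have hdec : ∀ j : Fin n, ∃ (ν : E →ₗ[A] (U × X)) (f : X →ₗ[A] (U × X)), ν ∈ N ∧
        LinearMap.inl A U X ∘ₗ LinearMap.proj j ∘ₗ i = ν + f ∘ₗ ε := by
      intro j
      have : LinearMap.inl A U X ∘ₗ LinearMap.proj j ∘ₗ i ∈
          N ⊔ LinearMap.range (homPrecomp A (T := U × X) ε) := hN ▸ Submodule.mem_top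
      rw [Submodule.mem_sup] at this
      obtain ⟨ν, hν, _, ⟨f, rfl⟩, h⟩ := this
      exact ⟨ν, f, hν, h.symm⟩
    choose ν f hν hd using hdec
    let P : Fin n → ((U × X) →ₗ[A] E) := fun j =>
      p ∘ₗ LinearMap.single A (fun _ => U) j ∘ₗ LinearMap.fst A U X
    let g : X →ₗ[A] E := ∑ j, P j ∘ₗ f j
    have hsum : ∀ e, e = (∑ j, P j (ν j e)) + g (ε e) := by
      intro e
      have h1 : p (i e) = e := LinearMap.congr_fun hpi e
      have h3 : ∀ j, P j (ν j e) + P j (f j (ε e)) = p (LinearMap.single A (fun _ => U) j (i e j)) := by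
        intro j
        have := LinearMap.congr_fun (hd j) e
        rw [← map_add]
        have h4 : ν j e + f j (ε e) = (i e j, 0) := this.symm
        rw [h4]; rfl
      simp only [g, LinearMap.sum_apply, LinearMap.comp_apply]
      rw [← Finset.sum_add_distrib, Finset.sum_congr rfl (fun j _ => h3 j), ← map_sum,
        aux_single, h1]
    have hu : IsUnit (1 - ε ∘ₗ g : Module.End A X) := by
      rcases aux_local hX (ε ∘ₗ g) with h | h
      · exfalso
        refine aux_not_add hX hbasic n (i ∘ₗ g) (ε ∘ₗ p) ?_
        convert h using 1
        ext x
        exact congrArg ε (LinearMap.congr_fun hpi (g x))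
      · exact h
    obtain ⟨w, hw1, hw2⟩ : ∃ w : Module.End A X, w * (1 - ε ∘ₗ g) = 1 ∧ (1 - ε ∘ₗ g) * w = 1 := by
      obtain ⟨u, hu⟩ := hu
      exact ⟨↑u⁻¹, by rw [← hu]; simp, by rw [← hu]; simp⟩
    -- inverse of `1 - g ε` is `1 + g w ε`
    rw [eq_top_iff]
    intro φ _
    let v : E →ₗ[A] E := LinearMap.id + g ∘ₗ w ∘ₗ ε
    have hφ : φ = ∑ j, ((φ ∘ₗ v ∘ₗ P j : Module.End A (U × X))) • ν j := by
      ext1 e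
      have h5 : ∑ j, P j (ν j e) = e - g (ε e) := by
        rw [eq_sub_iff_add_eq]; exact (hsum e).symm
      have h6 : w (ε e - ε (g (ε e))) = ε e := LinearMap.congr_fun hw1 (ε e)
      rw [LinearMap.sum_apply]
      have h7 : ∀ j, (((φ ∘ₗ v ∘ₗ P j : Module.End A (U × X))) • ν j) e
          = φ (v (P j (ν j e))) := fun j => rfl
      rw [Finset.sum_congr rfl (fun j _ => h7 j), ← map_sum, ← map_sum, h5]
      have h8 : v (e - g (ε e)) = e := by
        show (e - g (ε e)) + g (w (ε (e - g (ε e)))) = e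
        rw [map_sub ε, h6]; abel
      rw [h8]
    rw [hφ]
    exact Submodule.sum_mem _ fun j _ => N.smul_mem _ (hν j)
end
end

section
/- Let k be an algebraically closed field, A a finite-dimensional k-algebra, and T = U ⊕ X a basic semi-tilting left A-module with X indecomposable, X not in add U, and X ∈ gen U. Let 0 → Y →μ→ E →ε→ X → 0 be a short exact sequence with ε : E → X a minimal right add U-approximation, and assume dim_k Ext^1_A(X,Y) = 1. Then the image of the induced map Hom_A(X,ε) : Hom_A(X,E) → Hom_A(X,X) (given by g ↦ ε∘g) equals the Jacobson radical of the ring End_A(X). -/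
open CategoryTheory

noncomputable section

lemma aux_homology {k : Type} [Field k] (S : ShortComplex (ModuleCat.{0} k))
    (h : Module.finrank k S.homology = 1) (x y : S.X₂) (hx : S.g x = 0) (hy : S.g y = 0) :
    ∃ a b : k, (a ≠ 0 ∨ b ≠ 0) ∧ ∃ z : S.X₁, S.f z = a • x + b • y := by
  have h' : Module.finrank k S.moduleCatLeftHomologyData.H = 1 := by
    rw [← h]; exact (S.moduleCatHomologyIso.toLinearEquiv.finrank_eq).symm
  let q : LinearMap.ker S.g.hom →ₗ[k] S.moduleCatLeftHomologyData.H :=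
    (LinearMap.range S.moduleCatToCycles).mkQ
  obtain ⟨v, hv, hv'⟩ := finrank_eq_one_iff'.1 h'
  obtain ⟨c, hc⟩ := hv' (q ⟨x, hx⟩)
  obtain ⟨d, hd⟩ := hv' (q ⟨y, hy⟩)
  have key : ∀ a b : k, a * c + b * d = 0 → ∃ z : S.X₁, S.f z = a • x + b • y := by
    intro a b hab
    have h0 : q (a • ⟨x, hx⟩ + b • ⟨y, hy⟩) = 0 := by
      rw [map_add, map_smul, map_smul, ← hc, ← hd, smul_smul, smul_smul, ← add_smul, hab, zero_smul]
    have h1 := (Submodule.Quotient.mk_eq_zero _).1 h0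
    obtain ⟨z, hz⟩ := h1
    exact ⟨z, congrArg Subtype.val hz⟩
  by_cases hd0 : d = 0
  · exact ⟨0, 1, Or.inr one_ne_zero, key _ _ (by simp [hd0])⟩
  · exact ⟨d, -c, Or.inl hd0, key _ _ (by ring)⟩

lemma aux_cocycle {k : Type} [Field k] {C : Type 1} [Category.{0} C] [Abelian C] [Linear k C]
    [EnoughProjectives C] {X Y : C} (P : ProjectiveResolution X)
    (h : Module.finrank k (((Ext k C 1).obj (Opposite.op X)).obj Y) = 1)
    (x y : P.complex.X 1 ⟶ Y) (hx : P.complex.d 2 1 ≫ x = 0) (hy : P.complex.d 2 1 ≫ y = 0) :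
    ∃ a b : k, (a ≠ 0 ∨ b ≠ 0) ∧ ∃ z : P.complex.X 0 ⟶ Y,
      P.complex.d 1 0 ≫ z = a • x + b • y := by
  let K := P.complex.linearYonedaObj k Y
  have e : ((Ext k C 1).obj (Opposite.op X)).obj Y ≅ (K.sc' 0 1 2).homology :=
    P.isoExt 1 Y ≪≫ K.homologyIsoSc' 0 1 2 (by simp) (by simp)
  exact aux_homology (K.sc' 0 1 2) (e.toLinearEquiv.finrank_eq.symm.trans h) x y hx hy

lemma aux_lift {k : Type} [Field k] {C : Type 1} [Category.{0} C] [Abelian C] [Linear k C]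
    [EnoughProjectives C] {X Y E : C} (μ : Y ⟶ E) (ε : E ⟶ X) (w : μ ≫ ε = 0)
    (hS : (ShortComplex.mk μ ε w).ShortExact)
    (h : Module.finrank k (((Ext k C 1).obj (Opposite.op X)).obj Y) = 1)
    (f : X ⟶ X) :
    ∃ a b : k, (a ≠ 0 ∨ b ≠ 0) ∧ ∃ t : X ⟶ E, t ≫ ε = a • f + b • 𝟙 X := by
  let P := ProjectiveResolution.of X
  let p : P.complex.X 0 ⟶ X := P.π.f 0
  have hdp : P.complex.d 1 0 ≫ p = 0 := P.complex_d_comp_π_f_zero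
  have : Epi p := inferInstanceAs (Epi (P.π.f 0))
  have hex : (ShortComplex.mk (P.complex.d 1 0) p hdp).Exact := P.exact₀
  have : Epi ε := hS.epi_g
  have : Mono μ := hS.mono_f
  have : Projective (P.complex.X 0) := P.projective 0
  have main : ∀ f : X ⟶ X, ∃ (g : P.complex.X 0 ⟶ E) (x : P.complex.X 1 ⟶ Y),
      g ≫ ε = p ≫ f ∧ x ≫ μ = P.complex.d 1 0 ≫ g ∧ P.complex.d 2 1 ≫ x = 0 := by
    intro f
    refine ⟨Projective.factorThru (p ≫ f) ε, hS.exact.lift (P.complex.d 1 0 ≫ Projective.factorThru (p ≫ f) ε) ?_, ?_, ?_, ?_⟩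
    · simp [reassoc_of% hdp]
    · simp
    · exact hS.exact.lift_f _ _
    · rw [← cancel_mono μ, Category.assoc]
      have := hS.exact.lift_f (P.complex.d 1 0 ≫ Projective.factorThru (p ≫ f) ε) (by simp [reassoc_of% hdp])
      erw [this]
      simp
  obtain ⟨g, x, h1, h2, h3⟩ := main f
  obtain ⟨g', x', h1', h2', h3'⟩ := main (𝟙 X)
  obtain ⟨a, b, hab, z, hz⟩ := aux_cocycle P h x x' h3 h3'
  refine ⟨a, b, hab, ?_⟩
  have hd : P.complex.d 1 0 ≫ (a • g + b • g' - z ≫ μ) = 0 := by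
    rw [Preadditive.comp_sub, ← Category.assoc, hz]
    simp [h2, h2']
  refine ⟨hex.desc _ hd, ?_⟩
  rw [← cancel_epi p]
  have := hex.g_desc _ hd
  dsimp at this
  rw [reassoc_of% this]
  simp [h1, h1', w]

lemma aux_module (k : Type) [Field k] (A : Type) [Ring A] [Algebra k A] (X Y E : Type)
    [AddCommGroup X] [Module A X] [AddCommGroup Y] [Module A Y] [AddCommGroup E] [Module A E]
    (μ : Y →ₗ[A] E) (ε : E →ₗ[A] X)
    (hμ : Function.Injective μ) (hε : Function.Surjective ε)
    (hexact : LinearMap.range μ = LinearMap.ker ε)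
    (hext1 : Module.finrank k (((Ext k (ModuleCat.{0} A) 1).obj
        (Opposite.op (ModuleCat.of A X))).obj (ModuleCat.of A Y)) = 1) (f : X →ₗ[A] X) :
    ∃ a b : k, (a ≠ 0 ∨ b ≠ 0) ∧ ∃ t : X →ₗ[A] E,
      ∀ x, ε (t x) = algebraMap k A a • f x + algebraMap k A b • x := by
  have hex : Function.Exact μ ε := LinearMap.exact_iff.2 hexact.symm
  have w : ModuleCat.ofHom μ ≫ ModuleCat.ofHom ε = 0 := by
    ext y
    exact hex.apply_apply_eq_zero y
  obtain ⟨a, b, hab, t, ht⟩ := aux_lift (k := k) (ModuleCat.ofHom μ) (ModuleCat.ofHom ε) w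
    (ModuleCat.shortComplex_shortExact _ hex hμ hε) hext1 (ModuleCat.ofHom f)
  refine ⟨a, b, hab, t.hom, fun x => ?_⟩
  exact congrArg (fun (g : ModuleCat.of A X ⟶ ModuleCat.of A X) => g.hom x) ht

lemma aux_fitting {A : Type} [Ring A] {X : Type} [AddCommGroup X] [Module A X]
    [IsArtinian A X] [IsNoetherian A X] (hX : IsIndecomposableModule A X) (f : Module.End A X) :
    IsNilpotent f ∨ Function.Injective f := by
  obtain ⟨n, hn⟩ := Filter.eventually_atTop.1 f.eventually_isCompl_ker_pow_range_pow
  have h := hn (n + 1) (Nat.le_succ n)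
  rcases hX.2 _ _ h with h | h
  · right
    have h2 := LinearMap.ker_eq_bot.1 h
    rw [pow_succ] at h2
    exact Function.Injective.of_comp (f := (f ^ n)) (g := f) h2
  · left
    exact ⟨n + 1, LinearMap.range_eq_bot.1 h⟩

/-- the image of `Hom_A(X, ε) : Hom_A(X,E) → Hom_A(X,X)` equals the Jacobson
radical of the ring `End_A(X)`. -/
theorem image_hom_eps_eq_jacobson_radical
    (k : Type) [Field k] [IsAlgClosed k]
    (A : Type) [Ring A] [Algebra k A] [FiniteDimensional k A]
    (U X Y E : Type)
    [AddCommGroup U] [Module A U] [Module.Finite A U]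
    [AddCommGroup X] [Module A X] [Module.Finite A X]
    [AddCommGroup Y] [Module A Y] [Module.Finite A Y]
    [AddCommGroup E] [Module A E] [Module.Finite A E]
    (hbasic : IsBasicModule A (U × X))
    (hst : IsSemiTilting k A (U × X))
    (hX : IsIndecomposableModule A X)
    (hXU : ¬ InAdd A U X)
    (hgen : InGen A U X)
    (μ : Y →ₗ[A] E) (ε : E →ₗ[A] X)
    (hμ : Function.Injective μ) (hε : Function.Surjective ε)
    (hexact : LinearMap.range μ = LinearMap.ker ε)
    (hmin : IsMinimalRightAddApprox A U ε)
    (hext1 : Module.finrank k (((Ext k (ModuleCat.{0} A) 1).obj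
        (Opposite.op (ModuleCat.of A X))).obj (ModuleCat.of A Y)) = 1) :
    Set.range (fun g : X →ₗ[A] E => (ε ∘ₗ g : Module.End A X)) =
      (((⊥ : Ideal (Module.End A X)).jacobson : Ideal (Module.End A X)) :
        Set (Module.End A X)) := by
  have hart : IsArtinianRing A := IsArtinianRing.of_finite k A
  have hE : InAdd A U E := hmin.1.1
  have hno : ∀ t : X →ₗ[A] E, ε ∘ₗ t ≠ LinearMap.id := by
    intro t ht
    apply hXU
    obtain ⟨n, i, p, hip⟩ := hE
    refine ⟨n, i ∘ₗ t, ε ∘ₗ p, ?_⟩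
    rw [← ht]
    ext x
    have := LinearMap.congr_fun hip (t x)
    simp only [LinearMap.comp_apply, LinearMap.id_apply] at this ⊢
    rw [this]
  have hsub : ∀ t : X →ₗ[A] E,
      (ε ∘ₗ t : Module.End A X) ∈ (⊥ : Ideal (Module.End A X)).jacobson := by
    intro t
    rw [Ideal.mem_jacobson_iff]
    intro y
    rcases aux_fitting hX (y * (ε ∘ₗ t : Module.End A X)) with h | h
    · obtain ⟨u, hu⟩ := h.isUnit_one_add
      refine ⟨(↑u⁻¹ : Module.End A X), ?_⟩
      have : (↑u⁻¹ : Module.End A X) * (1 + y * (ε ∘ₗ t : Module.End A X)) = 1 := by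
        rw [← hu]; exact u.inv_mul
      rw [mul_add, mul_one, ← mul_assoc] at this
      rw [Ideal.mem_bot, ← this]
      abel
    · exfalso
      have h1 : Function.Injective (ε ∘ₗ t : Module.End A X) :=
        Function.Injective.of_comp (f := y) h
      have h2 := IsArtinian.bijective_of_injective_endomorphism _ h1
      let e := LinearEquiv.ofBijective _ h2
      apply hno (t ∘ₗ e.symm.toLinearMap)
      ext x
      exact e.apply_symm_apply x
  letI : Module k X := Module.restrictScalars k A X
  letI : Module k E := Module.restrictScalars k A E
  have : IsScalarTower k A X := IsScalarTower.restrictScalars k A X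
  have : IsScalarTower k A E := IsScalarTower.restrictScalars k A E
  have hεk : ∀ (c : k) (e : E), ε (c • e) = c • ε e := by
    intro c e
    rw [← algebraMap_smul A c e, map_smul, algebraMap_smul]
  have hne : (1 : Module.End A X) ∉ (⊥ : Ideal (Module.End A X)).jacobson := by
    intro h1
    have := hX.1
    obtain ⟨z, hz⟩ := Ideal.mem_jacobson_iff.1 h1 (-1)
    simp at hz
  ext f
  constructor
  · rintro ⟨t, rfl⟩
    exact hsub t
  · intro hf
    obtain ⟨a, b, hab, t, ht⟩ := aux_module k A X Y E μ ε hμ hε hexact hext1 f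
    simp only [algebraMap_smul] at ht
    have ha : a ≠ 0 := by
      intro ha
      have hb : b ≠ 0 := hab.resolve_left (fun h => h ha)
      apply hno (b⁻¹ • t)
      ext x
      simp [hεk, ht, ha, smul_smul, hb]
    have hb : b = 0 := by
      by_contra hb
      apply hne
      have h1 : (1 : Module.End A X) = (algebraMap k (Module.End A X) b⁻¹) *
          ((ε ∘ₗ t : Module.End A X) - algebraMap k (Module.End A X) a * f) := by
        ext x
        simp [ht, smul_smul, hb, Module.algebraMap_end_apply]
      rw [h1]
      exact Ideal.mul_mem_left _ _ (Ideal.sub_mem _ (hsub t) (Ideal.mul_mem_left _ _ hf))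
    refine ⟨a⁻¹ • t, ?_⟩
    ext x
    simp [hεk, ht, hb, smul_smul, ha]
end
end

section
/- Let k be an algebraically closed field, A a finite-dimensional k-algebra, and T = U ⊕ X a basic semi-tilting left A-module with X indecomposable, X not in add U, and X ∈ gen U. Let 0 → Y →μ→ E →ε→ X → 0 be a short exact sequence with ε : E → X a minimal right add U-approximation, assume dim_k Ext^1_A(X,Y) = 1, and set B = End_A(T). Then the image of the induced map ε_* = Hom_A(T,ε) : Hom_A(T,E) → Hom_A(T,X) of right B-modules (given by g ↦ ε∘g) equals the radical of the right B-module Hom_A(T,X), i.e., the intersection of all maximal B-submodules of Hom_A(T,X). -/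
open CategoryTheory

noncomputable section

lemma sc_aux {k : Type*} [Field k] (S : ShortComplex (ModuleCat k))
    (h : Module.finrank k S.homology = 1) (a b : S.X₂) (ha : S.g a = 0) (hb : S.g b = 0) :
    (∃ z, S.f z = a) ∨ ∃ (c : k) (z : _), S.f z = b - c • a := by
  have e := (S.moduleCatHomologyIso).toLinearEquiv
  rw [e.finrank_eq] at h
  change Module.finrank k (LinearMap.ker S.g.hom ⧸ LinearMap.range S.moduleCatToCycles) = 1 at h
  by_cases h0 : (LinearMap.range S.moduleCatToCycles).mkQ ⟨a, ha⟩ = 0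
  · left
    rw [Submodule.mkQ_apply, Submodule.Quotient.mk_eq_zero] at h0
    obtain ⟨z, hz⟩ := h0
    exact ⟨z, congrArg Subtype.val hz⟩
  · right
    obtain ⟨c, hc⟩ := exists_smul_eq_of_finrank_eq_one h h0 
      ((LinearMap.range S.moduleCatToCycles).mkQ ⟨b, hb⟩)
    rw [← map_smul, eq_comm, ← sub_eq_zero, ← map_sub, Submodule.mkQ_apply,
      Submodule.Quotient.mk_eq_zero] at hc
    obtain ⟨z, hz⟩ := hc
    exact ⟨c, z, congrArg Subtype.val hz⟩

lemma ext_aux {k : Type} [Field k] {C : Type*} [Category* C] [Abelian C] [Linear k C]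
    [EnoughProjectives C] (S : ShortComplex C) (hS : S.ShortExact) (X : C)
    (h : Module.finrank k (((Ext k C 1).obj (Opposite.op X)).obj S.X₁) = 1)
    (x y : X ⟶ S.X₃) : (∃ g : X ⟶ S.X₂, g ≫ S.g = x) ∨
      ∃ (c : k) (g : X ⟶ S.X₂), g ≫ S.g = y - c • x := by
  have := hS.mono_f
  have := hS.epi_g
  let P := ProjectiveResolution.of X
  have e := (P.isoExt (R := k) 1 S.X₁ ≪≫ ShortComplex.homologyMapIso
    (HomologicalComplex.isoSc' (P.complex.linearYonedaObj k S.X₁) 0 1 2 (by simp) (by simp))).toLinearEquiv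
  rw [e.finrank_eq] at h
  obtain ⟨p, hp0, hpe, hpd⟩ : ∃ p : P.complex.X 0 ⟶ X, P.complex.d 1 0 ≫ p = 0 ∧ Epi p ∧
      ∀ {Z : C} (f : P.complex.X 0 ⟶ Z), P.complex.d 1 0 ≫ f = 0 → ∃ l : X ⟶ Z, p ≫ l = f := by
    refine ⟨P.π.f 0, P.complex_d_comp_π_f_zero, inferInstanceAs (Epi (P.π.f 0)), ?_⟩
    intro Z f hf
    have : Epi (P.π.f 0) := inferInstance
    exact P.exact₀.desc' f hf
  have lift : ∀ x : X ⟶ S.X₃, ∃ (l : P.complex.X 0 ⟶ S.X₂) (φ : P.complex.X 1 ⟶ S.X₁), 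
      l ≫ S.g = p ≫ x ∧ φ ≫ S.f = P.complex.d 1 0 ≫ l ∧ P.complex.d 2 1 ≫ φ = 0 := by
    intro x
    let l := Projective.factorThru (p ≫ x) S.g
    have hl : l ≫ S.g = p ≫ x := Projective.factorThru_comp _ _
    have h1 : (P.complex.d 1 0 ≫ l) ≫ S.g = 0 := by
      rw [Category.assoc, hl, ← Category.assoc, hp0, Limits.zero_comp]
    refine ⟨l, hS.exact.lift _ h1, hl, hS.exact.lift_f _ _, ?_⟩
    rw [← cancel_mono S.f, Category.assoc, hS.exact.lift_f]
    simp
  have desc : ∀ (x : X ⟶ S.X₃) (l : P.complex.X 0 ⟶ S.X₂) (z : P.complex.X 0 ⟶ S.X₁),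
      l ≫ S.g = p ≫ x → P.complex.d 1 0 ≫ z ≫ S.f = P.complex.d 1 0 ≫ l →
      ∃ g : X ⟶ S.X₂, g ≫ S.g = x := by
    intro x l z hl hz
    have h1 : P.complex.d 1 0 ≫ (l - z ≫ S.f) = 0 := by
      rw [Preadditive.comp_sub, hz, sub_self]
    obtain ⟨g, hg⟩ := hpd _ h1
    refine ⟨g, ?_⟩
    rw [← cancel_epi p, ← Category.assoc, hg, Preadditive.sub_comp, hl]
    simp
  obtain ⟨lx, φx, hx1, hx2, hx3⟩ := lift x
  obtain ⟨ly, φy, hy1, hy2, hy3⟩ := lift y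
  rcases sc_aux _ h φx φy hx3 hy3 with ⟨z, hz⟩ | ⟨c, z, hz⟩
  · left
    obtain ⟨z, rfl⟩ : ∃ z' : P.complex.X 0 ⟶ S.X₁, z' = z := ⟨z, rfl⟩
    change P.complex.d 1 0 ≫ z = φx at hz
    exact desc x lx z hx1 (by rw [← Category.assoc, hz, hx2])
  · right
    obtain ⟨z, rfl⟩ : ∃ z' : P.complex.X 0 ⟶ S.X₁, z' = z := ⟨z, rfl⟩
    change P.complex.d 1 0 ≫ z = φy - c • φx at hz
    refine ⟨c, desc _ (ly - c • lx) z ?_ ?_⟩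
    · simp [hx1, hy1]
    · rw [← Category.assoc, hz]; simp [hx2, hy2]

lemma unit_or_nilp (A : Type) [Ring A] (X : Type) [AddCommGroup X] [Module A X]
    [IsArtinian A X] [IsNoetherian A X] (hX : IsIndecomposableModule A X)
    (w : Module.End A X) : IsUnit w ∨ IsNilpotent w := by
  obtain ⟨n, hn⟩ := Filter.eventually_atTop.mp w.eventually_isCompl_ker_pow_range_pow
  have h1 := hn (n + 1) (by omega)
  rcases hX.2 _ _ h1 with h | h
  · left
    have hb : Function.Bijective (w ^ (n + 1)) := by
      refine ⟨LinearMap.ker_eq_bot.mp h, LinearMap.range_eq_top.mp ?_⟩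
      have := h1.sup_eq_top
      rwa [h, bot_sup_eq] at this
    have hu : IsUnit (w ^ (n + 1)) := (Module.End.isUnit_iff _).mpr hb
    exact (isUnit_pow_iff (by omega)).mp hu
  · right
    exact ⟨n + 1, LinearMap.range_eq_bot.mp h⟩

lemma hom_aux (k : Type) [Field k]
    (A : Type) [Ring A] [Algebra k A]
    (X Y E : Type)
    [AddCommGroup X] [Module A X]
    [AddCommGroup Y] [Module A Y]
    [AddCommGroup E] [Module A E]
    (μ : Y →ₗ[A] E) (ε : E →ₗ[A] X)
    (hμ : Function.Injective μ) (hε : Function.Surjective ε)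
    (hexact : LinearMap.range μ = LinearMap.ker ε)
    (hext1 : Module.finrank k (((Ext k (ModuleCat.{0} A) 1).obj
        (Opposite.op (ModuleCat.of A X))).obj (ModuleCat.of A Y)) = 1)
    (x y : X →ₗ[A] X) : (∃ g : X →ₗ[A] E, ε ∘ₗ g = x) ∨
      ∃ (c : k) (g : X →ₗ[A] E), ∀ v, ε (g v) = y v - algebraMap k A c • x v := by
  let S : ShortComplex (ModuleCat.{0} A) := ShortComplex.mk (ModuleCat.ofHom μ) (ModuleCat.ofHom ε)
    (by ext v; exact (hexact.le ⟨v, rfl⟩ : μ v ∈ LinearMap.ker ε))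
  have hS : S.ShortExact := by
    apply ModuleCat.shortComplex_shortExact
    · intro v
      have := SetLike.ext_iff.mp hexact v
      exact this.symm
    · exact hμ
    · exact hε
  rcases ext_aux (k := k) S hS (ModuleCat.of A X) hext1 (ModuleCat.ofHom x) (ModuleCat.ofHom y) with
    ⟨g, hg⟩ | ⟨c, g, hg⟩
  · left
    refine ⟨g.hom, ?_⟩
    exact congrArg ModuleCat.Hom.hom hg
  · right
    refine ⟨c, g.hom, fun v => ?_⟩
    exact congrArg (fun f => ModuleCat.Hom.hom f v) hg

/-- scalar multiplication by `c` as an endomorphism -/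
def scal (k : Type) [Field k] (A : Type) [Ring A] [Algebra k A]
    (T : Type) [AddCommGroup T] [Module A T] (c : k) : Module.End A T where
  toFun v := algebraMap k A c • v
  map_add' := by intros; simp
  map_smul' := by
    intro a v
    simp only [RingHom.id_apply, smul_smul, Algebra.commutes c a]

/-- the image of `ε_* = Hom_A(T, ε) : Hom_A(T,E) → Hom_A(T,X)` equals the
radical (the intersection of all maximal submodules) of the right `B`-module
`Hom_A(T,X)`, where `B = End_A(T)` and `T = U ⊕ X`. -/
theorem image_hom_T_eps_eq_radical
    (k : Type) [Field k] [IsAlgClosed k]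
    (A : Type) [Ring A] [Algebra k A] [FiniteDimensional k A]
    (U X Y E : Type)
    [AddCommGroup U] [Module A U] [Module.Finite A U]
    [AddCommGroup X] [Module A X] [Module.Finite A X]
    [AddCommGroup Y] [Module A Y] [Module.Finite A Y]
    [AddCommGroup E] [Module A E] [Module.Finite A E]
    (hbasic : IsBasicModule A (U × X))
    (hst : IsSemiTilting k A (U × X))
    (hX : IsIndecomposableModule A X)
    (hXU : ¬ InAdd A U X)
    (hgen : InGen A U X)
    (μ : Y →ₗ[A] E) (ε : E →ₗ[A] X)
    (hμ : Function.Injective μ) (hε : Function.Surjective ε)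
    (hexact : LinearMap.range μ = LinearMap.ker ε)
    (hmin : IsMinimalRightAddApprox A U ε)
    (hext1 : Module.finrank k (((Ext k (ModuleCat.{0} A) 1).obj
        (Opposite.op (ModuleCat.of A X))).obj (ModuleCat.of A Y)) = 1) :
    LinearMap.range (homPostcomp A (T := U × X) ε) =
      sInf {N : Submodule (Module.End A (U × X))ᵐᵒᵖ ((U × X) →ₗ[A] X) | IsCoatom N} := by
  have : IsArtinianRing A := IsArtinianRing.of_finite k A
  have : IsNoetherianRing A := IsNoetherianRing.of_finite k A
  obtain ⟨⟨hE, happ⟩, -⟩ := hmin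
  have hU : InAdd A U U := ⟨1, LinearMap.pi fun _ => LinearMap.id, LinearMap.proj 0, by ext; simp⟩
  have hnf : ∀ w g, ε ∘ₗ g = w → ¬ IsUnit (w : Module.End A X) := by
    rintro w g rfl ⟨u, hu⟩
    obtain ⟨n, i, p, hip⟩ := hE
    refine hXU ⟨n, i ∘ₗ g ∘ₗ (↑u⁻¹ : Module.End A X), ε ∘ₗ p, ?_⟩
    have h1 : (u : Module.End A X) * (↑u⁻¹ : Module.End A X) = 1 := u.mul_inv
    rw [hu] at h1
    ext v
    have h2 := LinearMap.congr_fun hip (g ((↑u⁻¹ : Module.End A X) v))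
    have h3 := LinearMap.congr_fun h1 v
    simp at h2 h3 ⊢
    rw [h2, h3]
  have hfac : ∀ f : (U × X) →ₗ[A] X, (∃ g : X →ₗ[A] E, ε ∘ₗ g = f ∘ₗ LinearMap.inr A U X) →
      f ∈ LinearMap.range (homPostcomp A (T := U × X) ε) := by
    rintro f ⟨g, hg⟩
    obtain ⟨g', hg'⟩ := happ U hU (f ∘ₗ LinearMap.inl A U X)
    refine ⟨LinearMap.coprod g' g, ?_⟩
    change ε ∘ₗ LinearMap.coprod g' g = f
    apply LinearMap.prod_ext
    · rw [← hg']; ext; simp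
    · rw [← hg]; ext; simp
  have hgenr : ∀ (N : Submodule (Module.End A (U × X))ᵐᵒᵖ ((U × X) →ₗ[A] X)) (n), n ∈ N →
      IsUnit (n ∘ₗ LinearMap.inr A U X : Module.End A X) → N = ⊤ := by
    rintro N n hn ⟨u, hu⟩
    rw [eq_top_iff]
    intro f _
    have h1 : (u : Module.End A X) * (↑u⁻¹ : Module.End A X) = 1 := u.mul_inv
    rw [hu] at h1
    have := N.smul_mem (MulOpposite.op (LinearMap.inr A U X ∘ₗ (↑u⁻¹ : Module.End A X) ∘ₗ f)) hn
    convert this using 1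
    ext v <;> exact (LinearMap.congr_fun h1 _).symm
  apply le_antisymm
  · rw [le_sInf_iff]
    intro N hN
    by_contra hle
    have hsup := hN.2 _ (right_lt_sup.mpr hle)
    have hmem : LinearMap.snd A U X ∈ LinearMap.range (homPostcomp A (T := U × X) ε) ⊔ N := by
      rw [hsup]; trivial
    obtain ⟨w, ⟨g, hg⟩, n, hn, hwn⟩ := Submodule.mem_sup.mp hmem
    have hg' : ε ∘ₗ g = w := hg
    have h1 : (1 : Module.End A X) - w ∘ₗ LinearMap.inr A U X = n ∘ₗ LinearMap.inr A U X := by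
      ext v
      have := LinearMap.congr_fun hwn (0, v)
      simp at this ⊢
      rw [sub_eq_iff_eq_add', this]
    rcases unit_or_nilp A X hX (w ∘ₗ LinearMap.inr A U X) with hu | hu
    · exact hnf _ (g ∘ₗ LinearMap.inr A U X) (by rw [← hg']; rfl) hu
    · exact hN.1 (hgenr N n hn (h1 ▸ hu.isUnit_one_sub))
  · apply sInf_le
    constructor
    · intro htop
      have : LinearMap.snd A U X ∈ LinearMap.range (homPostcomp A (T := U × X) ε) := by
        rw [htop]; trivial
      obtain ⟨g, hg⟩ := this
      have hg' : ε ∘ₗ g = LinearMap.snd A U X := hg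
      refine hnf 1 (g ∘ₗ LinearMap.inr A U X) ?_ isUnit_one
      rw [← LinearMap.comp_assoc, hg']; ext; simp
    · intro N hN
      obtain ⟨hle, f, hf, hfW⟩ := SetLike.lt_iff_le_and_exists.mp hN
      rw [eq_top_iff]
      intro g _
      rcases hom_aux k A X Y E μ ε hμ hε hexact hext1 (f ∘ₗ LinearMap.inr A U X)
        (g ∘ₗ LinearMap.inr A U X) with h | ⟨c, h, hc⟩
      · exact absurd (hfac f h) hfW
      · have h1 : g - MulOpposite.op (scal k A (U × X) c) • f ∈ N := by
          apply hle
          apply hfac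
          refine ⟨h, ?_⟩
          ext v
          refine (hc v).trans ?_
          change g (0, v) - algebraMap k A c • f (0, v) =
            g (0, v) - f (algebraMap k A c • ((0, v) : U × X))
          rw [map_smul]
        have h2 := N.add_mem h1 (N.smul_mem (MulOpposite.op (scal k A (U × X) c)) hf)
        simpa using h2
end
end
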